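/- Let 0 < α < β < 1 and let f : I × I → ℝ be Hölder continuous with ∫₀¹ f(0,ω) dω = 0. Suppose there are constants 0 < γ < β and C_f < ∞ such that, uniformly in ω, |f(x,ω) − f(0,ω)| ≤ C_f x^γ for all x ∈ [0,1]. Then for every p with 1 ≤ p < min{2/α, 1/(α(1 − γ/β))}, the induced observable f_{Δ₀} belongs to L^p(Δ₀, ν), i.e. ∫_{Δ₀} |f_{Δ₀}|^p dν < ∞. -/

import Mathlib

open MeasureTheory Filter Set Topology

noncomputable section

/-- The Liverani–Saussol–Vaienti map `T_a` on `[0,1]`. -/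
def lsv (a x : ℝ) : ℝ := if x ≤ 1 / 2 then x * (1 + (2 : ℝ) ^ a * x ^ a) else 2 * x - 1

/-- Random parameter selection: `α` on `[0,p₁)`, `β` on `[p₁,1]`. -/
def alphaOf (α β p₁ ω : ℝ) : ℝ := if ω < p₁ then α else β

/-- The noise dynamics `φ` on `[0,1]`. -/
def phiMap (p₁ ω : ℝ) : ℝ := if ω < p₁ then ω / p₁ else (ω - p₁) / (1 - p₁)

/-- The skew product `S(x,ω) = (T_{α(ω)} x, φ ω)`. -/
def skewLSV (α β p₁ : ℝ) (p : ℝ × ℝ) : ℝ × ℝ :=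
  (lsv (alphaOf α β p₁ p.2) p.1, phiMap p₁ p.2)

/-- The base of inducing, `Δ₀ = (1/2,1] × [0,1]`. -/
def Δ0 : Set (ℝ × ℝ) := Ioc (1 / 2 : ℝ) 1 ×ˢ Icc (0 : ℝ) 1

/-- First return time of the skew product `S` to `Δ₀`. -/
def retTime (α β p₁ : ℝ) (p : ℝ × ℝ) : ℕ :=
  sInf {n : ℕ | 1 ≤ n ∧ (skewLSV α β p₁)^[n] p ∈ Δ0}

/-- The induced observable `f_{Δ₀}(x,ω) = Σ_{k<R(x,ω)} f(Sᵏ(x,ω))`. -/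
def inducedObs (α β p₁ : ℝ) (f : ℝ × ℝ → ℝ) (p : ℝ × ℝ) : ℝ :=
  ∑ k ∈ Finset.range (retTime α β p₁ p), f ((skewLSV α β p₁)^[k] p)

open scoped ENNReal

/-! ### The noise dynamics -/

section Noise

variable {p : ℝ}

lemma phiMap_left {x : ℝ} (hp : 0 < p) (hx : x < 1) : phiMap p (p * x) = x := by
  have : p * x < p := by nlinarith
  simp only [phiMap, if_pos this]
  field_simp

lemma phiMap_right {x : ℝ} (hp : p < 1) (hx : 0 ≤ x) : phiMap p (p + (1 - p) * x) = x := by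
  have : ¬ p + (1 - p) * x < p := by nlinarith
  have h : 1 - p ≠ 0 := by linarith
  simp only [phiMap, if_neg this]
  field_simp
  ring

lemma measurable_phiMap : Measurable (phiMap p) := by
  unfold phiMap
  exact Measurable.ite measurableSet_Iio (by fun_prop) (by fun_prop)

lemma phiMap_mem_Icc (hp : 0 < p) (hp' : p < 1) {x : ℝ} (hx : x ∈ Icc (0 : ℝ) 1) :
    phiMap p x ∈ Icc (0 : ℝ) 1 := by
  have h : 0 < 1 - p := by linarith
  unfold phiMap
  split_ifs with hlt
  · exact ⟨div_nonneg hx.1 hp.le, (div_le_one hp).2 hlt.le⟩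
  · exact ⟨div_nonneg (by linarith) h.le, (div_le_one h).2 (by linarith [hx.2])⟩

lemma phiMap_iterate_mem_Icc (hp : 0 < p) (hp' : p < 1) {x : ℝ} (hx : x ∈ Icc (0 : ℝ) 1) (n : ℕ) :
    (phiMap p)^[n] x ∈ Icc (0 : ℝ) 1 := by
  induction n with
  | zero => exact hx
  | succ n ih =>
    rw [Function.iterate_succ_apply']
    exact phiMap_mem_Icc hp hp' ih

lemma lintegral_Ico_split (hp : 0 < p) (hp' : p < 1) (F : ℝ → ℝ≥0∞) :
    ∫⁻ ω in Ico (0 : ℝ) 1, F ω =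
      ENNReal.ofReal p * (∫⁻ ω in Ico (0 : ℝ) 1, F (p * ω)) +
      ENNReal.ofReal (1 - p) * ∫⁻ ω in Ico (0 : ℝ) 1, F (p + (1 - p) * ω) := by
  have h1p : 0 < 1 - p := by linarith
  have hL : (fun x => p * x) '' Ico (0 : ℝ) 1 = Ico 0 p := by
    rw [Set.image_mul_left_Ico hp]; simp
  have hR : (fun x => p + (1 - p) * x) '' Ico (0 : ℝ) 1 = Ico p 1 := by
    have : (fun x => p + (1 - p) * x) = (fun x => p + x) ∘ (fun x => (1 - p) * x) := rfl
    rw [this, Set.image_comp, Set.image_mul_left_Ico h1p, Set.image_const_add_Ico]; simp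
  have hU : Ico (0 : ℝ) 1 = Ico 0 p ∪ Ico p 1 := (Ico_union_Ico_eq_Ico hp.le hp'.le).symm
  have hd : Disjoint (Ico (0 : ℝ) p) (Ico p 1) := by
    rw [Set.disjoint_left]; intro x hx hx'; exact absurd hx.2 (not_lt.2 hx'.1)
  have eL := lintegral_image_eq_lintegral_abs_deriv_mul (f := fun x => p * x) (f' := fun _ => p)
    (s := Ico (0 : ℝ) 1) measurableSet_Ico
    (fun x _ => by simpa using ((hasDerivAt_id x).const_mul p).hasDerivWithinAt)
    (fun x _ y _ h => mul_left_cancel₀ hp.ne' h) F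
  have eR := lintegral_image_eq_lintegral_abs_deriv_mul (f := fun x => p + (1 - p) * x)
    (f' := fun _ => 1 - p) (s := Ico (0 : ℝ) 1) measurableSet_Ico
    (fun x _ => by
      simpa using (((hasDerivAt_id x).const_mul (1 - p)).const_add p).hasDerivWithinAt)
    (fun x _ y _ h => mul_left_cancel₀ h1p.ne' (add_left_cancel h)) F
  rw [hL, abs_of_pos hp, lintegral_const_mul' _ _ ENNReal.ofReal_ne_top] at eL
  rw [hR, abs_of_pos h1p, lintegral_const_mul' _ _ ENNReal.ofReal_ne_top] at eR
  conv_lhs => rw [hU]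
  rw [lintegral_union measurableSet_Ico hd, eL, eR]

lemma measurable_birkhoffSum_phiMap {m : ℝ → ℝ} (hm : Measurable m) (n : ℕ) :
    Measurable (birkhoffSum (phiMap p) m n) := by
  unfold birkhoffSum
  exact Finset.measurable_sum _ fun k _ => hm.comp (measurable_phiMap.iterate k)

/-- Exponential moments of Birkhoff sums of reverse martingale differences. -/
lemma lintegral_exp_birkhoffSum_le (hp : 0 < p) (hp' : p < 1) {m : ℝ → ℝ} (hm : Measurable m)
    {M l : ℝ} (hM : ∀ ω ∈ Icc (0 : ℝ) 1, |m ω| ≤ M) (hl : |l| * M ≤ 1)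
    (h0 : ∀ ω ∈ Ico (0 : ℝ) 1, p * m (p * ω) + (1 - p) * m (p + (1 - p) * ω) = 0) (n : ℕ) :
    ∫⁻ ω in Ico (0 : ℝ) 1, ENNReal.ofReal (Real.exp (l * birkhoffSum (phiMap p) m n ω)) ≤
      ENNReal.ofReal (Real.exp (n * (l ^ 2 * M ^ 2))) := by
  have h1p : 0 < 1 - p := by linarith
  induction n with
  | zero => simp
  | succ n ih =>
    set E : ℝ → ℝ≥0∞ := fun ω => ENNReal.ofReal (Real.exp (l * birkhoffSum (phiMap p) m n ω))
      with hE
    have hEm : Measurable E :=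
      (((measurable_birkhoffSum_phiMap hm n).const_mul l).exp).ennreal_ofReal
    have key : ∀ y : ℝ, |y| ≤ 1 → Real.exp y ≤ 1 + y + y ^ 2 := fun y hy => by
      have := (abs_le.1 (Real.abs_exp_sub_one_sub_id_le hy)).2
      linarith
    have hb : ∀ ω ∈ Icc (0 : ℝ) 1, |l * m ω| ≤ 1 := fun ω hω => by
      rw [abs_mul]
      exact (mul_le_mul_of_nonneg_left (hM ω hω) (abs_nonneg l)).trans hl
    have hsq : ∀ ω ∈ Icc (0 : ℝ) 1, (l * m ω) ^ 2 ≤ l ^ 2 * M ^ 2 := fun ω hω => by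
      rw [mul_pow]
      refine mul_le_mul_of_nonneg_left ?_ (sq_nonneg l)
      exact sq_le_sq' (abs_le.1 (hM ω hω)).1 (abs_le.1 (hM ω hω)).2
    have step : ∀ ω, ENNReal.ofReal (Real.exp (l * birkhoffSum (phiMap p) m (n + 1) ω)) =
        ENNReal.ofReal (Real.exp (l * m ω)) * E (phiMap p ω) := fun ω => by
      rw [hE, birkhoffSum_succ', mul_add, Real.exp_add, ENNReal.ofReal_mul (Real.exp_nonneg _)]
    have hmeas : Measurable fun ω => ENNReal.ofReal p *
        (ENNReal.ofReal (Real.exp (l * m (p * ω))) * E (phiMap p (p * ω))) :=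
      ((((hm.comp (measurable_const_mul p)).const_mul l).exp).ennreal_ofReal.mul
        ((hEm.comp measurable_phiMap).comp (measurable_const_mul p))).const_mul _
    simp_rw [step]
    rw [lintegral_Ico_split hp hp', ← lintegral_const_mul' _ _ ENNReal.ofReal_ne_top,
      ← lintegral_const_mul' _ _ ENNReal.ofReal_ne_top, ← lintegral_add_left hmeas]
    calc _ ≤ ∫⁻ ω in Ico (0 : ℝ) 1, ENNReal.ofReal (Real.exp (l ^ 2 * M ^ 2)) * E ω := by
          refine setLIntegral_mono' measurableSet_Ico fun ω hω => ?_
          have hpω : p * ω ∈ Icc (0 : ℝ) 1 := ⟨mul_nonneg hp.le hω.1, by nlinarith [hω.2, hω.1]⟩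
          have hpω' : p + (1 - p) * ω ∈ Icc (0 : ℝ) 1 :=
            ⟨by nlinarith [hω.2, hω.1], by nlinarith [hω.2, hω.1]⟩
          rw [phiMap_left hp hω.2, phiMap_right hp' hω.1, ← mul_assoc, ← mul_assoc, ← add_mul]
          gcongr
          rw [← ENNReal.ofReal_mul hp.le, ← ENNReal.ofReal_mul h1p.le,
            ← ENNReal.ofReal_add (by positivity) (by positivity)]
          apply ENNReal.ofReal_le_ofReal
          have e1 := key _ (hb _ hpω)
          have e2 := key _ (hb _ hpω')
          have e3 := hsq _ hpω
          have e4 := hsq _ hpω'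
          have e5 := h0 ω hω
          have e6 := Real.add_one_le_exp (l ^ 2 * M ^ 2)
          have e7 : p * (l * m (p * ω)) + (1 - p) * (l * m (p + (1 - p) * ω)) = 0 := by
            linear_combination l * e5
          nlinarith [mul_le_mul_of_nonneg_left (e1.trans (add_le_add_right e3 _)) hp.le,
            mul_le_mul_of_nonneg_left (e2.trans (add_le_add_right e4 _)) h1p.le]
      _ ≤ ENNReal.ofReal (Real.exp (l ^ 2 * M ^ 2)) *
          ENNReal.ofReal (Real.exp (n * (l ^ 2 * M ^ 2))) := by
          rw [lintegral_const_mul' _ _ ENNReal.ofReal_ne_top]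
          gcongr
      _ = _ := by
          rw [← ENNReal.ofReal_mul (Real.exp_nonneg _), ← Real.exp_add]
          congr 2; push_cast; ring

end Noise

section Deviation

variable {p : ℝ}

/-- The parameters in `[0,1)` whose `n`-th Birkhoff sum exceeds `n ^ (1/2 + ε)`. -/
def deviationSet (p : ℝ) (m : ℝ → ℝ) (ε : ℝ) (n : ℕ) : Set ℝ :=
  {ω | (n : ℝ) ^ (1 / 2 + ε) < |birkhoffSum (phiMap p) m n ω|}

lemma measurableSet_deviationSet {m : ℝ → ℝ} (hm : Measurable m) (ε : ℝ) (n : ℕ) :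
    MeasurableSet (deviationSet p m ε n) :=
  measurableSet_lt measurable_const (measurable_birkhoffSum_phiMap hm n).norm

lemma volume_deviationSet_le (hp : 0 < p) (hp' : p < 1) {m : ℝ → ℝ} (hm : Measurable m)
    {M : ℝ} (hM0 : 0 < M) (hM : ∀ ω ∈ Icc (0 : ℝ) 1, |m ω| ≤ M)
    (h0 : ∀ ω ∈ Ico (0 : ℝ) 1, p * m (p * ω) + (1 - p) * m (p + (1 - p) * ω) = 0)
    (ε : ℝ) {n : ℕ} (hn : 1 ≤ n) :
    volume.restrict (Ico (0 : ℝ) 1) (deviationSet p m ε n) ≤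
      ENNReal.ofReal (2 * Real.exp (1 - (n : ℝ) ^ ε / M)) := by
  have hn0 : (0 : ℝ) < n := by exact_mod_cast hn
  have hn1 : (1 : ℝ) ≤ n := by exact_mod_cast hn
  set r : ℝ := (n : ℝ) ^ (1 / 2 : ℝ) with hr
  have hr1 : 1 ≤ r := Real.one_le_rpow hn1 (by norm_num)
  have hr0 : 0 < r := by linarith
  have hrr : r * r = n := by
    rw [hr, ← Real.rpow_add hn0]; norm_num
  have tail : ∀ l : ℝ, |l| = 1 / (M * r) →
      volume.restrict (Ico (0 : ℝ) 1)
        {ω | (n : ℝ) ^ ε / M ≤ l * birkhoffSum (phiMap p) m n ω} ≤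
      ENNReal.ofReal (Real.exp (1 - (n : ℝ) ^ ε / M)) := by
    intro l hl
    have h1 : |l| * M ≤ 1 := by
      rw [hl, div_mul_eq_mul_div, one_mul, div_le_one (by positivity)]
      nlinarith
    have h2 : (n : ℝ) * (l ^ 2 * M ^ 2) = 1 := by
      rw [← sq_abs, hl, ← hrr]
      field_simp
    have h3 := lintegral_exp_birkhoffSum_le hp hp' hm hM h1 h0 n
    rw [h2] at h3
    have h4 := mul_meas_ge_le_lintegral (μ := volume.restrict (Ico (0 : ℝ) 1))
      (((measurable_birkhoffSum_phiMap (p := p) hm n).const_mul l).exp).ennreal_ofReal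
      (ENNReal.ofReal (Real.exp ((n : ℝ) ^ ε / M)))
    rw [sub_eq_add_neg, Real.exp_add, Real.exp_neg, ENNReal.ofReal_mul (Real.exp_nonneg _),
      ENNReal.ofReal_inv_of_pos (Real.exp_pos _), ← div_eq_mul_inv,
      ENNReal.le_div_iff_mul_le (Or.inl (by simp [Real.exp_pos]))
      (Or.inl ENNReal.ofReal_ne_top), mul_comm]
    refine le_trans ?_ (h4.trans h3)
    gcongr
    intro hω
    exact ENNReal.ofReal_le_ofReal (Real.exp_le_exp.2 hω)
  have hsub : deviationSet p m ε n ⊆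
      {ω | (n : ℝ) ^ ε / M ≤ 1 / (M * r) * birkhoffSum (phiMap p) m n ω} ∪
      {ω | (n : ℝ) ^ ε / M ≤ -(1 / (M * r)) * birkhoffSum (phiMap p) m n ω} := by
    intro ω hω
    have e1 : (n : ℝ) ^ ε / M = 1 / (M * r) * (n : ℝ) ^ (1 / 2 + ε) := by
      rw [Real.rpow_add hn0]
      field_simp
      rw [hr]
    have hω' : (n : ℝ) ^ (1 / 2 + ε) < |birkhoffSum (phiMap p) m n ω| := hω
    rcases le_total 0 (birkhoffSum (phiMap p) m n ω) with h | h
    · left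
      rw [abs_of_nonneg h] at hω'
      rw [mem_ofPred_eq, e1]
      gcongr
    · right
      rw [abs_of_nonpos h] at hω'
      rw [mem_ofPred_eq, e1, neg_mul, ← mul_neg]
      gcongr
  refine (measure_mono hsub).trans ((measure_union_le _ _).trans ?_)
  rw [two_mul, ENNReal.ofReal_add (Real.exp_nonneg _) (Real.exp_nonneg _)]
  exact add_le_add (tail _ (abs_of_pos (by positivity)))
    (tail _ (by rw [abs_neg, abs_of_pos (by positivity)]))

lemma rpow_mul_exp_neg_le {M ε q : ℝ} (hM0 : 0 < M) (hε : 0 < ε) :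
    ∃ C : ℝ, ∀ n : ℕ, 1 ≤ n →
      (n : ℝ) ^ q * (2 * Real.exp (1 - (n : ℝ) ^ ε / M)) ≤ C * ((n : ℝ) ^ 2)⁻¹ := by
  obtain ⟨k, hk⟩ := exists_nat_ge ((q + 2) / ε)
  refine ⟨2 * Real.exp 1 * (k.factorial * M ^ k), fun n hn => ?_⟩
  have hn0 : (0 : ℝ) < n := by exact_mod_cast hn
  have hn1 : (1 : ℝ) ≤ n := by exact_mod_cast hn
  have h1 := Real.pow_div_factorial_le_exp (x := (n : ℝ) ^ ε / M) (by positivity) k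
  have h2 : (n : ℝ) ^ q * (n : ℝ) ^ 2 ≤ ((n : ℝ) ^ ε) ^ k := by
    rw [← Real.rpow_natCast ((n : ℝ) ^ ε), ← Real.rpow_mul hn0.le, ← Real.rpow_natCast (n : ℝ) 2,
      ← Real.rpow_add hn0]
    apply Real.rpow_le_rpow_of_exponent_le hn1
    rw [div_le_iff₀ hε] at hk
    push_cast
    linarith
  have hf : (0 : ℝ) < k.factorial := by exact_mod_cast k.factorial_pos
  rw [div_pow, div_div, div_le_iff₀ (by positivity)] at h1
  rw [sub_eq_add_neg, Real.exp_add, Real.exp_neg, ← div_eq_mul_inv _ ((n : ℝ) ^ 2),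
    le_div_iff₀ (by positivity)]
  have hE := Real.exp_pos ((n : ℝ) ^ ε / M)
  have h3 : (n : ℝ) ^ q * (n : ℝ) ^ 2 * (Real.exp ((n : ℝ) ^ ε / M))⁻¹ ≤ k.factorial * M ^ k := by
    rw [← div_eq_mul_inv, div_le_iff₀ hE]
    linarith
  have := mul_le_mul_of_nonneg_left h3 (by positivity : 0 ≤ 2 * Real.exp 1)
  linarith

lemma tsum_rpow_mul_volume_deviationSet_lt_top (hp : 0 < p) (hp' : p < 1) {m : ℝ → ℝ}
    (hm : Measurable m) {M : ℝ} (hM : ∀ ω ∈ Icc (0 : ℝ) 1, |m ω| ≤ M)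
    (h0 : ∀ ω ∈ Ico (0 : ℝ) 1, p * m (p * ω) + (1 - p) * m (p + (1 - p) * ω) = 0)
    {ε q : ℝ} (hε : 0 < ε) (hq : 0 < q) :
    ∑' n : ℕ, ENNReal.ofReal ((n : ℝ) ^ q) *
      volume.restrict (Ico (0 : ℝ) 1) (deviationSet p m ε n) < ⊤ := by
  have hM1 : 0 < |M| + 1 := by positivity
  obtain ⟨C, hC⟩ := rpow_mul_exp_neg_le (q := q) hM1 hε
  have hsum : Summable fun n : ℕ => C * ((n : ℝ) ^ 2)⁻¹ :=
    (Real.summable_nat_pow_inv.2 one_lt_two).mul_left C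
  refine lt_of_le_of_lt (ENNReal.tsum_le_tsum fun n => ?_) hsum.tsum_ofReal_lt_top
  rcases Nat.eq_zero_or_pos n with rfl | hn
  · simp [Real.zero_rpow hq.ne']
  · refine le_trans ?_ (ENNReal.ofReal_le_ofReal (hC n hn))
    rw [ENNReal.ofReal_mul (by positivity)]
    gcongr
    exact volume_deviationSet_le hp hp' hm hM1
      (fun ω hω => (hM ω hω).trans (by linarith [le_abs_self M])) h0 ε hn

end Deviation

section Coboundary

variable {p : ℝ}

/-- The transfer operator of the noise dynamics. -/
def noiseTransfer (p : ℝ) (h : ℝ → ℝ) (ω : ℝ) : ℝ := p * h (p * ω) + (1 - p) * h (p + (1 - p) * ω)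

lemma continuous_noiseTransfer {h : ℝ → ℝ} (hh : Continuous h) :
    Continuous (noiseTransfer p h) := by
  unfold noiseTransfer
  fun_prop

lemma integral_noiseTransfer (hp : 0 < p) (hp' : p < 1) {h : ℝ → ℝ} (hh : Continuous h) :
    ∫ ω in (0 : ℝ)..1, noiseTransfer p h ω = ∫ ω in (0 : ℝ)..1, h ω := by
  have h1p : 1 - p ≠ 0 := by linarith
  unfold noiseTransfer
  rw [intervalIntegral.integral_add (Continuous.intervalIntegrable (by fun_prop) _ _)
    (Continuous.intervalIntegrable (by fun_prop) _ _), intervalIntegral.integral_const_mul,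
    intervalIntegral.integral_const_mul, intervalIntegral.integral_comp_mul_left _ hp.ne',
    intervalIntegral.integral_comp_add_mul _ h1p, smul_eq_mul, smul_eq_mul,
    mul_inv_cancel_left₀ hp.ne', mul_inv_cancel_left₀ h1p]
  simp only [mul_zero, mul_one, add_zero, add_sub_cancel]
  exact intervalIntegral.integral_add_adjacent_intervals (hh.intervalIntegrable _ _)
    (hh.intervalIntegrable _ _)

lemma noiseTransfer_holder (hp : 0 < p) (hp' : p < 1) {h : ℝ → ℝ} {C t : ℝ} (hC0 : 0 ≤ C)
    (ht : 0 < t) (hC : ∀ x y, |h x - h y| ≤ C * |x - y| ^ t) (x y : ℝ) :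
    |noiseTransfer p h x - noiseTransfer p h y| ≤ C * (max p (1 - p)) ^ t * |x - y| ^ t := by
  have h1p : 0 < 1 - p := by linarith
  have hr : 0 < max p (1 - p) := lt_max_of_lt_left hp
  have e : ∀ a, 0 < a → a ≤ max p (1 - p) → C * |a * (x - y)| ^ t ≤
      C * (max p (1 - p)) ^ t * |x - y| ^ t := fun a ha hle => by
    rw [abs_mul, abs_of_pos ha, Real.mul_rpow ha.le (abs_nonneg _), mul_assoc]
    gcongr
  have e1 := hC (p * x) (p * y)
  rw [← mul_sub] at e1
  replace e1 := e1.trans (e p hp (le_max_left _ _))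
  have e2 := hC (p + (1 - p) * x) (p + (1 - p) * y)
  rw [add_sub_add_left_eq_sub, ← mul_sub] at e2
  replace e2 := e2.trans (e _ h1p (le_max_right _ _))
  have : noiseTransfer p h x - noiseTransfer p h y = p * (h (p * x) - h (p * y)) +
      (1 - p) * (h (p + (1 - p) * x) - h (p + (1 - p) * y)) := by
    unfold noiseTransfer; ring
  rw [this]
  refine (abs_add_le _ _).trans ?_
  rw [abs_mul, abs_mul, abs_of_pos hp, abs_of_pos h1p]
  nlinarith [mul_le_mul_of_nonneg_left e1 hp.le, mul_le_mul_of_nonneg_left e2 h1p.le]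

lemma abs_le_of_integral_eq_zero {h : ℝ → ℝ} (hh : Continuous h)
    (h0 : ∫ ω in (0 : ℝ)..1, h ω = 0) {C t : ℝ} (hC0 : 0 ≤ C) (ht : 0 < t)
    (hC : ∀ x y, |h x - h y| ≤ C * |x - y| ^ t) {x : ℝ} (hx : x ∈ Icc (0 : ℝ) 1) :
    |h x| ≤ C := by
  have e : h x = ∫ y in (0 : ℝ)..1, (h x - h y) := by
    rw [intervalIntegral.integral_sub (by simp) (hh.intervalIntegrable _ _), h0]
    simp
  rw [e]
  have := intervalIntegral.norm_integral_le_of_norm_le_const (a := 0) (b := 1) (C := C)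
    (f := fun y => h x - h y) fun y hy => by
      rw [uIoc_of_le zero_le_one] at hy
      refine (hC x y).trans (mul_le_of_le_one_right hC0 ?_)
      exact Real.rpow_le_one (abs_nonneg _)
        (abs_le.2 ⟨by linarith [hx.1, hy.2], by linarith [hx.2, hy.1]⟩) ht.le
  simpa using this

/-- Gordin's decomposition of a centred Hölder function of the noise. -/
lemma exists_martingale_coboundary (hp : 0 < p) (hp' : p < 1) {g : ℝ → ℝ} (hg : Continuous g)
    (h0 : ∫ ω in (0 : ℝ)..1, g ω = 0) {C t : ℝ} (hC0 : 0 ≤ C) (ht : 0 < t)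
    (hC : ∀ x y, |g x - g y| ≤ C * |x - y| ^ t) :
    ∃ (χ m : ℝ → ℝ) (M : ℝ), Measurable m ∧ (∀ ω ∈ Icc (0 : ℝ) 1, |m ω| ≤ M) ∧
      (∀ ω ∈ Icc (0 : ℝ) 1, |χ ω| ≤ M) ∧
      (∀ ω ∈ Ico (0 : ℝ) 1, p * m (p * ω) + (1 - p) * m (p + (1 - p) * ω) = 0) ∧
      ∀ ω, g ω = m ω + χ (phiMap p ω) - χ ω := by
  have h1p : 0 < 1 - p := by linarith
  set ρ : ℝ := (max p (1 - p)) ^ t with hρ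
  have hρ0 : 0 ≤ ρ := by positivity
  have hρ1 : ρ < 1 := Real.rpow_lt_one (by positivity) (max_lt hp' (by linarith)) ht
  set G : ℕ → ℝ → ℝ := fun n => (noiseTransfer p)^[n] g with hG
  have hGs : ∀ n, G (n + 1) = noiseTransfer p (G n) := fun n => Function.iterate_succ_apply' _ _ _
  have hGc : ∀ n, Continuous (G n) := fun n => by
    induction n with
    | zero => exact hg
    | succ n ih => rw [hGs]; exact continuous_noiseTransfer ih
  have hG0 : ∀ n, ∫ ω in (0 : ℝ)..1, G n ω = 0 := fun n => by
    induction n with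
    | zero => exact h0
    | succ n ih => rw [hGs, integral_noiseTransfer hp hp' (hGc n), ih]
  have hGH : ∀ n x y, |G n x - G n y| ≤ C * ρ ^ n * |x - y| ^ t := fun n => by
    induction n with
    | zero =>
      intro x y
      rw [pow_zero, mul_one]
      exact hC x y
    | succ n ih =>
      intro x y
      rw [hGs, pow_succ, ← mul_assoc]
      exact noiseTransfer_holder hp hp' (by positivity) ht ih x y
  have hGb : ∀ n, ∀ x ∈ Icc (0 : ℝ) 1, |G n x| ≤ C * ρ ^ n := fun n x hx =>
    abs_le_of_integral_eq_zero (hGc n) (hG0 n) (by positivity) ht (hGH n) hx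
  have hgeo : ∀ K : ℝ, Summable fun n => K * ρ ^ n := fun K =>
    (summable_geometric_of_lt_one hρ0 hρ1).mul_left K
  have hsum : ∀ ω, Summable fun n => G n ω := fun ω => by
    refine Summable.of_norm_bounded (hgeo (C * (1 + |ω| ^ t))) fun n => ?_
    have e1 := hGb n 0 ⟨le_rfl, zero_le_one⟩
    have e2 := hGH n ω 0
    rw [sub_zero] at e2
    rw [Real.norm_eq_abs]
    have := abs_sub_abs_le_abs_sub (G n ω) (G n 0)
    nlinarith
  have hsum1 : ∀ ω, Summable fun n => G (n + 1) ω := fun ω =>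
    (summable_nat_add_iff 1).2 (hsum ω)
  set χ : ℝ → ℝ := fun ω => ∑' n, G (n + 1) ω with hχ
  have hχb : ∀ ω ∈ Icc (0 : ℝ) 1, |χ ω| ≤ ∑' n, C * ρ ^ n := fun ω hω => by
    refine tsum_of_norm_bounded (f := fun n => G (n + 1) ω) (hgeo C).hasSum
      fun n => le_trans (hGb (n + 1) ω hω) ?_
    rw [pow_succ]
    have : 0 ≤ C * ρ ^ n := by positivity
    nlinarith
  have hχm : Measurable χ := by
    refine measurable_of_tendsto_metrizable (f := fun (N : ℕ) ω => ∑ n ∈ Finset.range N, G (n + 1) ω)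
      (fun N => Finset.measurable_sum _ fun n _ => (hGc (n + 1)).measurable) ?_
    rw [tendsto_pi_nhds]
    exact fun ω => (hsum1 ω).hasSum.tendsto_sum_nat
  have hPχ : ∀ ω, p * χ (p * ω) + (1 - p) * χ (p + (1 - p) * ω) = χ ω - G 1 ω := fun ω => by
    rw [hχ]
    simp only
    rw [← tsum_mul_left, ← tsum_mul_left, ← ((hsum1 _).mul_left p).tsum_add
      ((hsum1 _).mul_left (1 - p)), (hsum1 ω).tsum_eq_zero_add]
    simp only [zero_add, add_sub_cancel_left]
    exact tsum_congr fun n => by rw [hGs (n + 1)]; rfl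
  refine ⟨χ, fun ω => g ω + χ ω - χ (phiMap p ω), C + 2 * ∑' n, C * ρ ^ n,
    (hg.measurable.add hχm).sub (hχm.comp measurable_phiMap), fun ω hω => ?_, fun ω hω => ?_,
    fun ω hω => ?_, fun ω => by ring⟩
  · have e1 := hGb 0 ω hω
    have e2 := hχb ω hω
    have e3 := hχb _ (phiMap_mem_Icc hp hp' hω)
    simp only [pow_zero, mul_one] at e1
    have e1' : |g ω| ≤ C := e1
    calc _ ≤ |g ω + χ ω| + |χ (phiMap p ω)| := abs_sub _ _
      _ ≤ |g ω| + |χ ω| + |χ (phiMap p ω)| := by gcongr; exact abs_add_le _ _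
      _ ≤ _ := by linarith
  · have := hχb ω hω
    have := (abs_nonneg _).trans this
    linarith
  · simp only
    rw [phiMap_left hp hω.2, phiMap_right hp' hω.1]
    have e := hPχ ω
    have e' : G 1 ω = p * g (p * ω) + (1 - p) * g (p + (1 - p) * ω) := rfl
    linear_combination e - e'

end Coboundary

section Branch

/-- The odd extension to `ℝ` of the left branch of the LSV map. -/
def leftBranch (a x : ℝ) : ℝ := x * (1 + (2 : ℝ) ^ a * |x| ^ a)

/-- The derivative of the left branch on `[0, ∞)`. -/
def leftDeriv (a x : ℝ) : ℝ := 1 + (a + 1) * (2 : ℝ) ^ a * |x| ^ a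

variable {a : ℝ}

lemma lsv_of_le {x : ℝ} (hx0 : 0 ≤ x) (hx : x ≤ 1 / 2) : lsv a x = leftBranch a x := by
  rw [lsv, if_pos hx, leftBranch, abs_of_nonneg hx0]

lemma lsv_of_lt {x : ℝ} (hx : 1 / 2 < x) : lsv a x = 2 * x - 1 := by
  rw [lsv, if_neg (not_le.2 hx)]

lemma leftBranch_half : leftBranch a (1 / 2) = 1 := by
  rw [leftBranch, abs_of_pos (by norm_num), ← Real.mul_rpow (by norm_num) (by norm_num)]
  norm_num

lemma leftBranch_zero : leftBranch a 0 = 0 := by simp [leftBranch]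

lemma le_leftBranch {x : ℝ} (hx : 0 ≤ x) : x ≤ leftBranch a x := by
  have : 0 ≤ (2 : ℝ) ^ a * |x| ^ a := by positivity
  unfold leftBranch
  nlinarith

lemma continuous_leftBranch (ha : 0 < a) : Continuous (leftBranch a) := by
  unfold leftBranch
  have : Continuous fun x : ℝ => |x| ^ a := continuous_abs.rpow_const fun _ => Or.inr ha.le
  fun_prop

lemma continuous_leftDeriv (ha : 0 < a) : Continuous (leftDeriv a) := by
  unfold leftDeriv
  have : Continuous fun x : ℝ => |x| ^ a := continuous_abs.rpow_const fun _ => Or.inr ha.le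
  fun_prop

lemma one_le_leftDeriv (ha : 0 < a) (x : ℝ) : 1 ≤ leftDeriv a x := by
  have : 0 ≤ (a + 1) * (2 : ℝ) ^ a * |x| ^ a := by positivity
  unfold leftDeriv
  linarith

lemma leftDeriv_le_leftDeriv (ha : 0 < a) {x y : ℝ} (hx : 0 ≤ x) (hxy : x ≤ y) :
    leftDeriv a x ≤ leftDeriv a y := by
  unfold leftDeriv
  rw [abs_of_nonneg hx, abs_of_nonneg (hx.trans hxy)]
  gcongr

lemma leftBranch_add_le (ha : 0 < a) {x y : ℝ} (hx : 0 ≤ x) (hy : 0 ≤ y) :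
    leftBranch a x + leftBranch a y ≤ leftBranch a (x + y) := by
  unfold leftBranch
  rw [abs_of_nonneg hx, abs_of_nonneg hy, abs_of_nonneg (add_nonneg hx hy)]
  have h1 : x ^ a ≤ (x + y) ^ a := Real.rpow_le_rpow hx (by linarith) ha.le
  have h2 : y ^ a ≤ (x + y) ^ a := Real.rpow_le_rpow hy (by linarith) ha.le
  have h3 : 0 < (2 : ℝ) ^ a := by positivity
  nlinarith [mul_le_mul_of_nonneg_left h1 (mul_nonneg hx h3.le),
    mul_le_mul_of_nonneg_left h2 (mul_nonneg hy h3.le)]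

lemma strictMono_leftBranch (ha : 0 < a) : StrictMono (leftBranch a) := by
  apply strictMono_of_odd_strictMonoOn_nonneg
  · intro x
    simp [leftBranch]
  · intro x hx y hy hxy
    have hx : 0 ≤ x := hx
    have h := leftBranch_add_le ha hx (sub_nonneg.2 hxy.le)
    rw [add_sub_cancel] at h
    have := le_leftBranch (a := a) (sub_nonneg.2 hxy.le)
    linarith

lemma surjective_leftBranch (ha : 0 < a) : Function.Surjective (leftBranch a) := by
  apply (continuous_leftBranch ha).surjective
  · refine tendsto_atTop_mono' _ ?_ tendsto_id
    filter_upwards [eventually_ge_atTop 0] with x hx using le_leftBranch hx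
  · refine tendsto_atBot_mono' _ ?_ tendsto_id
    filter_upwards [eventually_le_atBot 0] with x hx
    have := le_leftBranch (a := a) (neg_nonneg.2 hx)
    simp only [leftBranch, abs_neg] at this ⊢
    simp only [id]
    linarith

lemma leftBranch_le_of_le {b x : ℝ} (hab : a ≤ b) (hx0 : 0 ≤ x) (hx : x ≤ 1 / 2) :
    leftBranch b x ≤ leftBranch a x := by
  unfold leftBranch
  rw [abs_of_nonneg hx0, ← Real.mul_rpow zero_le_two hx0, ← Real.mul_rpow zero_le_two hx0]
  rcases hx0.eq_or_lt with rfl | h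
  · simp
  · have := Real.rpow_le_rpow_of_exponent_ge (by linarith : 0 < 2 * x) (by linarith) hab
    gcongr

lemma leftBranch_le_two_mul (ha : 0 < a) {x : ℝ} (hx0 : 0 ≤ x) (hx : x ≤ 1 / 2) :
    leftBranch a x ≤ 2 * x := by
  unfold leftBranch
  rw [abs_of_nonneg hx0, ← Real.mul_rpow zero_le_two hx0]
  have := Real.rpow_le_one (by linarith : 0 ≤ 2 * x) (by linarith) ha.le
  nlinarith

lemma hasDerivAt_leftBranch {x : ℝ} (hx : 0 < x) :
    HasDerivAt (leftBranch a) (leftDeriv a x) x := by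
  have h : HasDerivAt (fun x : ℝ => x * (1 + (2 : ℝ) ^ a * x ^ a))
      (1 * (1 + (2 : ℝ) ^ a * x ^ a) + x * ((2 : ℝ) ^ a * (a * x ^ (a - 1)))) x :=
    (hasDerivAt_id x).mul
      (((Real.hasDerivAt_rpow_const (Or.inl hx.ne')).const_mul _).const_add 1)
  have e : leftDeriv a x = 1 * (1 + (2 : ℝ) ^ a * x ^ a) +
      x * ((2 : ℝ) ^ a * (a * x ^ (a - 1))) := by
    rw [leftDeriv, abs_of_pos hx, Real.rpow_sub_one hx.ne']
    field_simp
    ring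
  rw [e]
  refine h.congr_of_eventuallyEq ?_
  filter_upwards [lt_mem_nhds hx] with y hy
  rw [leftBranch, abs_of_pos hy]

open Classical in
/-- The inverse of the left branch of the LSV map. -/
def leftInv (a : ℝ) : ℝ → ℝ :=
  if h : 0 < a then
    ((strictMono_leftBranch h).orderIsoOfSurjective _ (surjective_leftBranch h)).symm
  else id

lemma leftBranch_leftInv (ha : 0 < a) (x : ℝ) : leftBranch a (leftInv a x) = x := by
  rw [leftInv, dif_pos ha]
  exact ((strictMono_leftBranch ha).orderIsoOfSurjective _
    (surjective_leftBranch ha)).apply_symm_apply x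

lemma leftInv_leftBranch (ha : 0 < a) (x : ℝ) : leftInv a (leftBranch a x) = x :=
  (strictMono_leftBranch ha).injective (leftBranch_leftInv ha _)

lemma strictMono_leftInv (ha : 0 < a) : StrictMono (leftInv a) := by
  intro x y hxy
  rw [← (strictMono_leftBranch ha).lt_iff_lt, leftBranch_leftInv ha, leftBranch_leftInv ha]
  exact hxy

lemma measurable_leftInv (ha : 0 < a) : Measurable (leftInv a) :=
  (strictMono_leftInv ha).monotone.measurable

lemma leftInv_mem_Ioc (ha : 0 < a) {x : ℝ} (hx : x ∈ Ioc (0 : ℝ) 1) :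
    leftInv a x ∈ Ioc (0 : ℝ) (1 / 2) := by
  constructor
  · rw [← (strictMono_leftBranch ha).lt_iff_lt, leftBranch_leftInv ha, leftBranch_zero]
    exact hx.1
  · rw [← (strictMono_leftBranch ha).le_iff_le, leftBranch_leftInv ha, leftBranch_half]
    exact hx.2

lemma image_leftBranch (ha : 0 < a) :
    leftBranch a '' Ioc (0 : ℝ) (1 / 2) = Ioc (0 : ℝ) 1 := by
  ext y
  constructor
  · rintro ⟨x, hx, rfl⟩
    have h1 := strictMono_leftBranch ha hx.1
    have h2 := (strictMono_leftBranch ha).monotone hx.2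
    rw [leftBranch_zero] at h1
    rw [leftBranch_half] at h2
    exact ⟨h1, h2⟩
  · intro hy
    exact ⟨leftInv a y, leftInv_mem_Ioc ha hy, leftBranch_leftInv ha y⟩

lemma lsv_mem_Ioc (ha : 0 < a) {x : ℝ} (hx : x ∈ Ioc (0 : ℝ) 1) : lsv a x ∈ Ioc (0 : ℝ) 1 := by
  rcases le_or_gt x (1 / 2) with h | h
  · rw [lsv_of_le hx.1.le h, ← image_leftBranch ha]
    exact mem_image_of_mem _ ⟨hx.1, h⟩
  · rw [lsv_of_lt h]
    exact ⟨by linarith, by linarith [hx.2]⟩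

lemma measurable_lsv (a : ℝ) : Measurable (lsv a) := by
  unfold lsv
  refine Measurable.ite measurableSet_Iic ?_ (by fun_prop)
  exact measurable_id.mul (((measurable_id.pow_const a).const_mul _).const_add 1)

lemma lintegral_lsv (ha : 0 < a) (F k : ℝ → ℝ≥0∞) :
    ∫⁻ x in Ioc (0 : ℝ) 1, F (lsv a x) * k x =
      (∫⁻ x in Ioc (0 : ℝ) 1, F x *
        (k (leftInv a x) * ENNReal.ofReal ((leftDeriv a (leftInv a x))⁻¹))) +
      ∫⁻ x in Ioc (0 : ℝ) 1, F x * (k ((x + 1) / 2) * ENNReal.ofReal (1 / 2)) := by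
  have hU : Ioc (0 : ℝ) 1 = Ioc 0 (1 / 2) ∪ Ioc (1 / 2) 1 :=
    (Ioc_union_Ioc_eq_Ioc (by norm_num) (by norm_num)).symm
  have hd : Disjoint (Ioc (0 : ℝ) (1 / 2)) (Ioc (1 / 2) 1) := by
    rw [Set.disjoint_left]; intro x hx hx'; exact absurd hx.2 (not_le.2 hx'.1)
  have hR : (fun x : ℝ => 2 * x - 1) '' Ioc (1 / 2) 1 = Ioc (0 : ℝ) 1 := by
    ext y
    constructor
    · rintro ⟨x, hx, rfl⟩
      exact ⟨by simp only; linarith [hx.1], by simp only; linarith [hx.2]⟩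
    · intro hy
      exact ⟨(y + 1) / 2, ⟨by linarith [hy.1], by linarith [hy.2]⟩, by ring⟩
  have eL := lintegral_image_eq_lintegral_abs_deriv_mul (f := leftBranch a) (f' := leftDeriv a)
    (s := Ioc (0 : ℝ) (1 / 2)) measurableSet_Ioc
    (fun x hx => (hasDerivAt_leftBranch hx.1).hasDerivWithinAt)
    ((strictMono_leftBranch ha).injective.injOn) (fun x => F x *
        (k (leftInv a x) * ENNReal.ofReal ((leftDeriv a (leftInv a x))⁻¹)))
  have eR := lintegral_image_eq_lintegral_abs_deriv_mul (f := fun x : ℝ => 2 * x - 1)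
    (f' := fun _ => 2) (s := Ioc (1 / 2 : ℝ) 1) measurableSet_Ioc
    (fun x _ => by
      simpa using (((hasDerivAt_id x).const_mul 2).sub_const 1).hasDerivWithinAt)
    (fun x _ y _ h => by simp only at h; linarith)
    (fun x => F x * (k ((x + 1) / 2) * ENNReal.ofReal (1 / 2)))
  rw [image_leftBranch ha] at eL
  rw [hR] at eR
  rw [eL, eR]
  conv_lhs => rw [hU]
  rw [lintegral_union measurableSet_Ioc hd]
  congr 1
  · refine setLIntegral_congr_fun measurableSet_Ioc fun x hx => ?_
    have h1 := one_le_leftDeriv ha x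
    rw [lsv_of_le hx.1.le hx.2, leftInv_leftBranch ha, mul_comm (k x), mul_left_comm,
      ← mul_assoc (ENNReal.ofReal _) (ENNReal.ofReal _),
      ← ENNReal.ofReal_mul (abs_nonneg _), abs_of_pos (by linarith),
      mul_inv_cancel₀ (by linarith), ENNReal.ofReal_one, one_mul]
  · refine setLIntegral_congr_fun measurableSet_Ioc fun x hx => ?_
    rw [lsv_of_lt hx.1, mul_comm (k _), mul_left_comm, ← mul_assoc (ENNReal.ofReal _)
      (ENNReal.ofReal _), ← ENNReal.ofReal_mul (abs_nonneg _), abs_of_pos (by norm_num)]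
    norm_num

end Branch

section Distortion

variable {α β p₁ : ℝ}

lemma alphaOf_pos (hα : 0 < α) (hαβ : α < β) (ω : ℝ) : 0 < alphaOf α β p₁ ω := by
  unfold alphaOf
  split_ifs
  exacts [hα, hα.trans hαβ]

lemma alphaOf_le (hαβ : α < β) (ω : ℝ) : alphaOf α β p₁ ω ≤ β := by
  unfold alphaOf
  split_ifs
  exacts [hαβ.le, le_rfl]

lemma measurable_skewLSV : Measurable (skewLSV α β p₁) := by
  refine Measurable.prodMk ?_ (measurable_phiMap.comp measurable_snd)
  have : (fun p : ℝ × ℝ => lsv (alphaOf α β p₁ p.2) p.1) =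
      fun p : ℝ × ℝ => if p.2 < p₁ then lsv α p.1 else lsv β p.1 := by
    funext p
    unfold alphaOf
    split_ifs <;> rfl
  rw [this]
  exact Measurable.ite (measurableSet_lt measurable_snd measurable_const)
    ((measurable_lsv α).comp measurable_fst) ((measurable_lsv β).comp measurable_fst)

/-- A half-open version of the unit square, on which the branches of the skew product are full. -/
def unitSquare : Set (ℝ × ℝ) := Ioc (0 : ℝ) 1 ×ˢ Ico (0 : ℝ) 1

lemma measurableSet_unitSquare : MeasurableSet unitSquare :=
  measurableSet_Ioc.prod measurableSet_Ico

lemma volume_unitSquare : volume unitSquare = 1 := by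
  rw [unitSquare, Measure.volume_eq_prod, Measure.prod_prod]
  simp

lemma setLIntegral_unitSquare {H : ℝ × ℝ → ℝ≥0∞} (hH : Measurable H) :
    ∫⁻ q in unitSquare, H q = ∫⁻ ω in Ico (0 : ℝ) 1, ∫⁻ x in Ioc (0 : ℝ) 1, H (x, ω) := by
  rw [unitSquare, Measure.volume_eq_prod, ← Measure.prod_restrict, lintegral_prod_symm' _ hH]

/-- The contribution of one noise symbol, with inverse noise branch `τ`, to the transfer operator. -/
lemma setLIntegral_branch {a : ℝ} (ha : 0 < a) {τ : ℝ → ℝ} (hτ : Measurable τ)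
    {F k : ℝ × ℝ → ℝ≥0∞} (hF : Measurable F) (hk : Measurable k) :
    ∫⁻ ω in Ico (0 : ℝ) 1, ∫⁻ x in Ioc (0 : ℝ) 1, F (lsv a x, ω) * k (x, τ ω) =
      (∫⁻ q in unitSquare, F q * (k (leftInv a q.1, τ q.2) *
        ENNReal.ofReal ((leftDeriv a (leftInv a q.1))⁻¹))) +
      ∫⁻ q in unitSquare, F q * (k ((q.1 + 1) / 2, τ q.2) * ENNReal.ofReal (1 / 2)) := by
  have hv := measurable_leftInv ha
  have hd := (continuous_leftDeriv ha).measurable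
  rw [setLIntegral_unitSquare (by fun_prop), setLIntegral_unitSquare (by fun_prop),
    ← lintegral_add_left]
  · refine lintegral_congr fun ω => ?_
    exact lintegral_lsv ha (fun x => F (x, ω)) (fun x => k (x, τ ω))
  · exact Measurable.lintegral_prod_left' (f := fun q : ℝ × ℝ => F q * (k (leftInv a q.1, τ q.2) *
        ENNReal.ofReal ((leftDeriv a (leftInv a q.1))⁻¹))) (by fun_prop)

lemma setLIntegral_comp_skewLSV (hα : 0 < α) (hαβ : α < β) (hp₁ : 0 < p₁) (hp₁' : p₁ < 1)
    {F k : ℝ × ℝ → ℝ≥0∞} (hF : Measurable F) (hk : Measurable k) :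
    ∫⁻ q in unitSquare, F (skewLSV α β p₁ q) * k q =
      ENNReal.ofReal p₁ *
        ((∫⁻ q in unitSquare, F q * (k (leftInv α q.1, p₁ * q.2) *
          ENNReal.ofReal ((leftDeriv α (leftInv α q.1))⁻¹))) +
        ∫⁻ q in unitSquare, F q * (k ((q.1 + 1) / 2, p₁ * q.2) * ENNReal.ofReal (1 / 2))) +
      ENNReal.ofReal (1 - p₁) *
        ((∫⁻ q in unitSquare, F q * (k (leftInv β q.1, p₁ + (1 - p₁) * q.2) *
          ENNReal.ofReal ((leftDeriv β (leftInv β q.1))⁻¹))) +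
        ∫⁻ q in unitSquare, F q * (k ((q.1 + 1) / 2, p₁ + (1 - p₁) * q.2) *
          ENNReal.ofReal (1 / 2))) := by
  have hS := measurable_skewLSV (α := α) (β := β) (p₁ := p₁)
  rw [setLIntegral_unitSquare (by fun_prop), lintegral_Ico_split hp₁ hp₁',
    ← setLIntegral_branch hα (τ := fun ω => p₁ * ω) (by fun_prop) hF hk,
    ← setLIntegral_branch (hα.trans hαβ) (τ := fun ω => p₁ + (1 - p₁) * ω) (by fun_prop) hF hk]
  congr 2
  · refine setLIntegral_congr_fun measurableSet_Ico fun ω hω => ?_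
    have h : p₁ * ω < p₁ := by nlinarith [hω.2]
    simp only [skewLSV, alphaOf, if_pos h, phiMap_left hp₁ hω.2]
  · refine setLIntegral_congr_fun measurableSet_Ico fun ω hω => ?_
    have h : ¬ p₁ + (1 - p₁) * ω < p₁ := by nlinarith [hω.1]
    simp only [skewLSV, alphaOf, if_neg h, phiMap_right hp₁' hω.1]

/-- The backward orbit of `1` under the left branch, which bounds the widths of cylinders. -/
def cylWidth (β : ℝ) (n : ℕ) : ℝ := (leftInv β)^[n] 1

lemma leftBranch_cylWidth (hβ : 0 < β) (n : ℕ) :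
    leftBranch β (cylWidth β (n + 1)) = cylWidth β n := by
  rw [cylWidth, Function.iterate_succ_apply', leftBranch_leftInv hβ, cylWidth]

lemma cylWidth_mem (hβ : 0 < β) (n : ℕ) : cylWidth β n ∈ Ioc (0 : ℝ) 1 := by
  induction n with
  | zero => exact ⟨zero_lt_one, le_rfl⟩
  | succ n ih =>
    rw [cylWidth, Function.iterate_succ_apply']
    have := leftInv_mem_Ioc hβ ih
    exact ⟨this.1, this.2.trans (by norm_num)⟩

lemma cylWidth_succ_le_half (hβ : 0 < β) (n : ℕ) : cylWidth β (n + 1) ≤ 1 / 2 := by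
  rw [cylWidth, Function.iterate_succ_apply']
  exact (leftInv_mem_Ioc hβ (cylWidth_mem hβ n)).2

lemma tendsto_cylWidth (hβ : 0 < β) : Tendsto (cylWidth β) atTop (𝓝 0) := by
  have hanti : Antitone (cylWidth β) := antitone_nat_of_succ_le fun n => by
    rw [← leftBranch_cylWidth hβ n]
    exact le_leftBranch (cylWidth_mem hβ _).1.le
  have hbdd : BddBelow (range (cylWidth β)) :=
    ⟨0, by rintro _ ⟨n, rfl⟩; exact (cylWidth_mem hβ n).1.le⟩
  have hlim := tendsto_atTop_ciInf hanti hbdd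
  set l := ⨅ n, cylWidth β n with hl
  have h1 : Tendsto (fun n => leftBranch β (cylWidth β (n + 1))) atTop (𝓝 (leftBranch β l)) :=
    ((continuous_leftBranch hβ).tendsto l).comp (hlim.comp (tendsto_add_atTop_nat 1))
  simp_rw [leftBranch_cylWidth hβ] at h1
  have h2 : leftBranch β l = l := tendsto_nhds_unique h1 hlim
  have h3 : l = 0 := by
    by_contra hne
    have : 0 < |l| ^ β := Real.rpow_pos_of_pos (abs_pos.2 hne) _
    have h5 : l * ((2 : ℝ) ^ β * |l| ^ β) = 0 := by
      unfold leftBranch at h2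
      linarith
    rcases mul_eq_zero.1 h5 with h | h
    · exact hne h
    · have : 0 < (2 : ℝ) ^ β * |l| ^ β := by positivity
      linarith
  rwa [h3] at hlim

lemma abs_leftInv_sub_le {a : ℝ} (ha : 0 < a) (hab : a ≤ β) {x y : ℝ} (hx : x ∈ Ioc (0 : ℝ) 1)
    (hy : y ∈ Ioc (0 : ℝ) 1) {n : ℕ} (h : |x - y| ≤ cylWidth β n) :
    |leftInv a x - leftInv a y| ≤ cylWidth β (n + 1) := by
  have hβ : 0 < β := ha.trans_le hab
  wlog hyx : y ≤ x generalizing x y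
  · rw [abs_sub_comm]
    exact this hy hx (by rwa [abs_sub_comm]) (le_of_not_ge hyx)
  have hm := (strictMono_leftInv ha).monotone hyx
  have hx' := leftInv_mem_Ioc ha hx
  have hy' := leftInv_mem_Ioc ha hy
  have h0 : 0 ≤ leftInv a x - leftInv a y := by linarith
  rw [abs_of_nonneg h0, ← (strictMono_leftBranch hβ).le_iff_le, leftBranch_cylWidth hβ]
  have h1 := leftBranch_add_le ha h0 hy'.1.le
  rw [sub_add_cancel, leftBranch_leftInv ha, leftBranch_leftInv ha] at h1
  have h2 := leftBranch_le_of_le hab h0 (by linarith [hx'.2, hy'.1])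
  linarith [(abs_le.1 h).2]

/-- Oscillation at most `ε` on rectangles of the size of `n`-cylinders. -/
def CylOsc (β p₁ ε : ℝ) (n : ℕ) (g : ℝ × ℝ → ℝ≥0∞) : Prop :=
  ∀ q ∈ unitSquare, ∀ q' ∈ unitSquare, |q.1 - q'.1| ≤ cylWidth β n →
    |q.2 - q'.2| ≤ (max p₁ (1 - p₁)) ^ n → g q ≤ g q' + ENNReal.ofReal ε

lemma CylOsc.comp {ε : ℝ} {n : ℕ} {g : ℝ × ℝ → ℝ≥0∞} (hg : CylOsc β p₁ ε (n + 1) g)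
    {v τ : ℝ → ℝ} {s : ℝ} (hv : ∀ x ∈ Ioc (0 : ℝ) 1, v x ∈ Ioc (0 : ℝ) 1)
    (hvw : ∀ x ∈ Ioc (0 : ℝ) 1, ∀ y ∈ Ioc (0 : ℝ) 1, |x - y| ≤ cylWidth β n →
      |v x - v y| ≤ cylWidth β (n + 1))
    (hτ : ∀ ω ∈ Ico (0 : ℝ) 1, τ ω ∈ Ico (0 : ℝ) 1) (hs0 : 0 ≤ s) (hs : s ≤ max p₁ (1 - p₁))
    (hτs : ∀ x y, |τ x - τ y| = s * |x - y|) :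
    CylOsc β p₁ ε n fun q => g (v q.1, τ q.2) := by
  intro q hq q' hq' h1 h2
  refine hg _ ⟨hv _ hq.1, hτ _ hq.2⟩ _ ⟨hv _ hq'.1, hτ _ hq'.2⟩ (hvw _ hq.1 _ hq'.1 h1) ?_
  simp only
  rw [hτs, pow_succ']
  exact mul_le_mul hs h2 (abs_nonneg _) (hs0.trans hs)

/-- Bounded distortion, with constant `2`, for the `n`-th iterate of the skew product. -/
lemma setLIntegral_iterate_le (hα : 0 < α) (hαβ : α < β) (hp₁ : 0 < p₁) (hp₁' : p₁ < 1)
    {B : Set (ℝ × ℝ)} (hB : MeasurableSet B) (hBΔ : B ⊆ Δ0) {ε : ℝ} (n : ℕ) :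
    ∀ (g : ℝ × ℝ → ℝ≥0∞) (D : ℝ → ℝ≥0∞), Measurable g → Measurable D →
      AntitoneOn D (Ioc (0 : ℝ) 1) → CylOsc β p₁ ε n g →
      ∫⁻ q in unitSquare, B.indicator 1 ((skewLSV α β p₁)^[n] q) * (g q * D q.1) ≤
        2 * volume B * ∫⁻ q in unitSquare, (g q + ENNReal.ofReal ε) * D q.1 := by
  have h1p : 0 < 1 - p₁ := by linarith
  have hβ : 0 < β := hα.trans hαβ
  have hind : Measurable (B.indicator (1 : ℝ × ℝ → ℝ≥0∞)) := measurable_one.indicator hB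
  induction n with
  | zero =>
    intro g D hg hD hanti hosc
    set K := 2 * ∫⁻ q in unitSquare, (g q + ENNReal.ofReal ε) * D q.1 with hK
    have hpt : ∀ q ∈ unitSquare, q ∈ B → g q * D q.1 ≤ K := by
      intro q hq hqB
      have hhalf : ∫⁻ q' in Ioc (0 : ℝ) (1 / 2) ×ˢ Ico (0 : ℝ) 1, g q * D q.1 ≤
          ∫⁻ q in unitSquare, (g q + ENNReal.ofReal ε) * D q.1 := by
        refine le_trans (setLIntegral_mono' (measurableSet_Ioc.prod measurableSet_Ico)
          (g := fun q' => (g q' + ENNReal.ofReal ε) * D q'.1) fun q' hq' => ?_)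
          (lintegral_mono_set (prod_mono_left (Ioc_subset_Ioc_right (by norm_num))))
        have hq's : q' ∈ unitSquare := ⟨⟨hq'.1.1, hq'.1.2.trans (by norm_num)⟩, hq'.2⟩
        gcongr
        · refine hosc q hq q' hq's ?_ ?_
          · change _ ≤ (1 : ℝ)
            exact abs_le.2 ⟨by linarith [hq.1.1, hq's.1.2], by linarith [hq.1.2, hq's.1.1]⟩
          · rw [pow_zero]
            exact abs_le.2 ⟨by linarith [hq.2.1, hq's.2.2], by linarith [hq.2.2, hq's.2.1]⟩
        · exact hanti hq's.1 hq.1 (hq'.1.2.trans (hBΔ hqB).1.1.le)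
      have hvol : volume (Ioc (0 : ℝ) (1 / 2) ×ˢ Ico (0 : ℝ) 1) = ENNReal.ofReal (1 / 2) := by
        rw [Measure.volume_eq_prod, Measure.prod_prod, Real.volume_Ioc, Real.volume_Ico, sub_zero,
          sub_zero, ENNReal.ofReal_one, mul_one]
      rw [setLIntegral_const, hvol] at hhalf
      calc g q * D q.1 = 2 * (g q * D q.1 * ENNReal.ofReal (1 / 2)) := by
            rw [mul_left_comm, show (2 : ℝ≥0∞) = ENNReal.ofReal 2 by simp,
              ← ENNReal.ofReal_mul (by norm_num)]
            norm_num
        _ ≤ K := by rw [hK]; gcongr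
    calc _ ≤ ∫⁻ q in unitSquare, B.indicator 1 q * K := by
          refine setLIntegral_mono' measurableSet_unitSquare fun q hq => ?_
          simp only [Function.iterate_zero, id]
          by_cases hqB : q ∈ B
          · gcongr
            exact hpt q hq hqB
          · simp [hqB]
      _ ≤ ∫⁻ q, B.indicator 1 q * K := setLIntegral_le_lintegral _ _
      _ = _ := by
          rw [lintegral_mul_const _ hind, lintegral_indicator_one hB, hK]
          ring
  | succ n ih =>
    intro g D hg hD hanti hosc
    have hS := (measurable_skewLSV (α := α) (β := β) (p₁ := p₁)).iterate n
    have hF : Measurable fun q => B.indicator (1 : ℝ × ℝ → ℝ≥0∞) ((skewLSV α β p₁)^[n] q) :=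
      hind.comp hS
    have hk : Measurable fun q : ℝ × ℝ => g q * D q.1 := by fun_prop
    have hk' : Measurable fun q : ℝ × ℝ => (g q + ENNReal.ofReal ε) * D q.1 := by fun_prop
    have e1 := setLIntegral_comp_skewLSV hα hαβ hp₁ hp₁' hF hk
    have e2 := setLIntegral_comp_skewLSV hα hαβ hp₁ hp₁' (F := fun _ => 1) measurable_const hk'
    simp only [one_mul] at e2
    simp only [Function.iterate_succ_apply]
    rw [e1, e2]
    have hleft : ∀ (a : ℝ), 0 < a → a ≤ β → ∀ (τ : ℝ → ℝ) (s : ℝ), Measurable τ →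
        (∀ ω ∈ Ico (0 : ℝ) 1, τ ω ∈ Ico (0 : ℝ) 1) → 0 ≤ s → s ≤ max p₁ (1 - p₁) →
        (∀ x y, |τ x - τ y| = s * |x - y|) →
        ∫⁻ q in unitSquare, B.indicator 1 ((skewLSV α β p₁)^[n] q) *
          (g (leftInv a q.1, τ q.2) * D (leftInv a q.1) *
            ENNReal.ofReal ((leftDeriv a (leftInv a q.1))⁻¹)) ≤
        2 * volume B * ∫⁻ q in unitSquare, (g (leftInv a q.1, τ q.2) + ENNReal.ofReal ε) *
          D (leftInv a q.1) * ENNReal.ofReal ((leftDeriv a (leftInv a q.1))⁻¹) := by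
      intro a ha hab τ s hτ hτm hs0 hs hτs
      have hv := measurable_leftInv ha
      have hd := (continuous_leftDeriv ha).measurable
      have hvm : ∀ x ∈ Ioc (0 : ℝ) 1, leftInv a x ∈ Ioc (0 : ℝ) 1 := fun x hx =>
        ⟨(leftInv_mem_Ioc ha hx).1, (leftInv_mem_Ioc ha hx).2.trans (by norm_num)⟩
      have := ih (fun q => g (leftInv a q.1, τ q.2))
        (fun x => D (leftInv a x) * ENNReal.ofReal ((leftDeriv a (leftInv a x))⁻¹))
        (by fun_prop) (by fun_prop) (fun x hx y hy hxy => by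
          have hm := (strictMono_leftInv ha).monotone hxy
          have h1 := one_le_leftDeriv ha (leftInv a x)
          have h2 := leftDeriv_le_leftDeriv ha (leftInv_mem_Ioc ha hx).1.le hm
          refine mul_le_mul' (hanti (hvm x hx) (hvm y hy) hm) ?_
          exact ENNReal.ofReal_le_ofReal (inv_anti₀ (by linarith) h2))
        (hosc.comp hvm (fun x hx y hy h => abs_leftInv_sub_le ha hab hx hy h) hτm hs0 hs hτs)
      simpa only [mul_assoc] using this
    have hright : ∀ (τ : ℝ → ℝ) (s : ℝ), Measurable τ →
        (∀ ω ∈ Ico (0 : ℝ) 1, τ ω ∈ Ico (0 : ℝ) 1) → 0 ≤ s → s ≤ max p₁ (1 - p₁) →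
        (∀ x y, |τ x - τ y| = s * |x - y|) →
        ∫⁻ q in unitSquare, B.indicator 1 ((skewLSV α β p₁)^[n] q) *
          (g ((q.1 + 1) / 2, τ q.2) * D ((q.1 + 1) / 2) * ENNReal.ofReal (1 / 2)) ≤
        2 * volume B * ∫⁻ q in unitSquare, (g ((q.1 + 1) / 2, τ q.2) + ENNReal.ofReal ε) *
          D ((q.1 + 1) / 2) * ENNReal.ofReal (1 / 2) := by
      intro τ s hτ hτm hs0 hs hτs
      have hvm : ∀ x ∈ Ioc (0 : ℝ) 1, (x + 1) / 2 ∈ Ioc (0 : ℝ) 1 := fun x hx =>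
        ⟨by linarith [hx.1], by linarith [hx.2]⟩
      have := ih (fun q => g ((q.1 + 1) / 2, τ q.2))
        (fun x => D ((x + 1) / 2) * ENNReal.ofReal (1 / 2))
        (by fun_prop) (by fun_prop) (fun x hx y hy hxy => by
          refine mul_le_mul' (hanti (hvm x hx) (hvm y hy) (by linarith)) le_rfl)
        (hosc.comp (v := fun x => (x + 1) / 2) hvm (fun x hx y hy h => by
          have h1 := leftBranch_le_two_mul hβ (cylWidth_mem hβ (n + 1)).1.le
            (cylWidth_succ_le_half hβ n)
          rw [leftBranch_cylWidth hβ] at h1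
          rw [← sub_div, add_sub_add_right_eq_sub, abs_div, abs_two]
          linarith) hτm hs0 hs hτs)
      simpa only [mul_assoc] using this
    have t1 : ∀ ω ∈ Ico (0 : ℝ) 1, p₁ * ω ∈ Ico (0 : ℝ) 1 := fun ω hω =>
      ⟨mul_nonneg hp₁.le hω.1, by nlinarith [hω.2, hω.1]⟩
    have t2 : ∀ ω ∈ Ico (0 : ℝ) 1, p₁ + (1 - p₁) * ω ∈ Ico (0 : ℝ) 1 := fun ω hω =>
      ⟨by nlinarith [hω.2, hω.1], by nlinarith [hω.2, hω.1]⟩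
    have s1 : ∀ x y : ℝ, |p₁ * x - p₁ * y| = p₁ * |x - y| := fun x y => by
      rw [← mul_sub, abs_mul, abs_of_pos hp₁]
    have s2 : ∀ x y : ℝ, |p₁ + (1 - p₁) * x - (p₁ + (1 - p₁) * y)| = (1 - p₁) * |x - y| :=
      fun x y => by rw [add_sub_add_left_eq_sub, ← mul_sub, abs_mul, abs_of_pos h1p]
    have L1 := hleft α hα hαβ.le (fun ω => p₁ * ω) p₁ (by fun_prop) t1 hp₁.le (le_max_left _ _) s1
    have L2 := hleft β hβ le_rfl (fun ω => p₁ + (1 - p₁) * ω) (1 - p₁) (by fun_prop) t2 h1p.le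
      (le_max_right _ _) s2
    have R1 := hright (fun ω => p₁ * ω) p₁ (by fun_prop) t1 hp₁.le (le_max_left _ _) s1
    have R2 := hright (fun ω => p₁ + (1 - p₁) * ω) (1 - p₁) (by fun_prop) t2 h1p.le
      (le_max_right _ _) s2
    rw [mul_add (2 * volume B), mul_left_comm (2 * volume B), mul_left_comm (2 * volume B),
      mul_add (2 * volume B), mul_add (2 * volume B)]
    gcongr

end Distortion

section Density

variable {α β p₁ : ℝ}

lemma exists_cylOsc (hβ : 0 < β) (hp₁ : 0 < p₁) (hp₁' : p₁ < 1) {g : ℝ × ℝ → ℝ}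
    (hg : Continuous g) {ε : ℝ} (hε : 0 < ε) :
    ∃ n, CylOsc β p₁ ε n fun q => ENNReal.ofReal (g q) := by
  have huc : UniformContinuousOn g (Icc (0 : ℝ) 1 ×ˢ Icc (0 : ℝ) 1) :=
    (isCompact_Icc.prod isCompact_Icc).uniformContinuousOn_of_continuous hg.continuousOn
  obtain ⟨δ, hδ, hd⟩ := Metric.uniformContinuousOn_iff.1 huc ε hε
  have hr : Tendsto (fun n : ℕ => (max p₁ (1 - p₁)) ^ n) atTop (𝓝 0) :=
    tendsto_pow_atTop_nhds_zero_of_lt_one (le_max_of_le_left hp₁.le)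
      (max_lt hp₁' (by linarith))
  obtain ⟨n, hn1, hn2⟩ := (((tendsto_cylWidth hβ).eventually (gt_mem_nhds hδ)).and
    (hr.eventually (gt_mem_nhds hδ))).exists
  refine ⟨n, fun q hq q' hq' h1 h2 => ?_⟩
  have hdist : dist q q' < δ := by
    rw [Prod.dist_eq, Real.dist_eq, Real.dist_eq]
    exact max_lt (h1.trans_lt hn1) (h2.trans_lt hn2)
  have h := hd q ⟨Ioc_subset_Icc_self hq.1, Ico_subset_Icc_self hq.2⟩ q'
    ⟨Ioc_subset_Icc_self hq'.1, Ico_subset_Icc_self hq'.2⟩ hdist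
  rw [Real.dist_eq] at h
  refine le_trans (ENNReal.ofReal_le_ofReal ?_) ENNReal.ofReal_add_le
  linarith [(abs_lt.1 h).2]

lemma measure_compl_unitSquare {ν : Measure (ℝ × ℝ)} (hac : ν ≪ volume)
    (hsupp : ν ((Icc (0 : ℝ) 1 ×ˢ Icc (0 : ℝ) 1)ᶜ) = 0) : ν unitSquareᶜ = 0 := by
  have h : (unitSquare : Set (ℝ × ℝ)) =ᵐ[volume] Icc (0 : ℝ) 1 ×ˢ Icc (0 : ℝ) 1 := by
    rw [unitSquare, Measure.volume_eq_prod]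
    exact Measure.set_prod_ae_eq Ioc_ae_eq_Icc Ico_ae_eq_Icc
  have h' : (unitSquare : Set (ℝ × ℝ)) =ᵐ[ν] Icc (0 : ℝ) 1 ×ˢ Icc (0 : ℝ) 1 := hac.ae_le h
  rw [measure_congr h'.compl]
  exact hsupp

lemma volume_Δ0_le_one : volume Δ0 ≤ 1 := by
  rw [Δ0, Measure.volume_eq_prod, Measure.prod_prod, Real.volume_Ioc, Real.volume_Icc,
    ← ENNReal.ofReal_mul (by norm_num)]
  norm_num

/-- An absolutely continuous invariant probability measure has density at most `2` on `Δ0`. -/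
lemma measure_le_two_mul_volume (hα : 0 < α) (hαβ : α < β) (hp₁ : 0 < p₁) (hp₁' : p₁ < 1)
    (ν : Measure (ℝ × ℝ)) [IsProbabilityMeasure ν] (hac : ν ≪ volume)
    (hsupp : ν ((Icc (0 : ℝ) 1 ×ˢ Icc (0 : ℝ) 1)ᶜ) = 0)
    (hinv : ∀ A : Set (ℝ × ℝ), MeasurableSet A → ν (skewLSV α β p₁ ⁻¹' A) = ν A)
    {B : Set (ℝ × ℝ)} (hB : MeasurableSet B) (hBΔ : B ⊆ Δ0) :
    ν B ≤ 2 * volume B := by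
  have hβ : 0 < β := hα.trans hαβ
  set h := ν.rnDeriv volume with hh
  have hhm : Measurable h := Measure.measurable_rnDeriv ν volume
  have hνA : ∀ A, MeasurableSet A → ν A = ∫⁻ q in unitSquare, A.indicator 1 q * h q := by
    intro A hA
    have e : ν A = ν (A ∩ unitSquare) := by
      rw [measure_inter_conull (measure_compl_unitSquare hac hsupp)]
    have e' : ν = volume.withDensity h := (Measure.withDensity_rnDeriv_eq ν volume hac).symm
    rw [e]
    nth_rw 1 [e']
    rw [withDensity_apply _ (hA.inter measurableSet_unitSquare), ← Measure.restrict_restrict hA,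
      ← lintegral_indicator hA]
    refine lintegral_congr fun q => ?_
    by_cases hq : q ∈ A <;> simp [hq]
  have hmp : MeasurePreserving (skewLSV α β p₁) ν ν :=
    ⟨measurable_skewLSV, Measure.ext fun A hA => by
      rw [Measure.map_apply measurable_skewLSV hA, hinv A hA]⟩
  have hsq : ∫⁻ q in unitSquare, h q ≤ 1 := by
    have := hνA univ MeasurableSet.univ
    simp only [indicator_univ, Pi.one_apply, one_mul, measure_univ] at this
    exact this.symm.le
  have hvolB : volume B ≤ 1 := (measure_mono hBΔ).trans volume_Δ0_le_one
  refine ENNReal.le_of_forall_pos_le_add fun ε hε _ => ?_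
  set δ : ℝ := ε / 5 with hδ
  have hδ0 : 0 < δ := div_pos (by exact_mod_cast hε) (by norm_num)
  obtain ⟨g, -, hgδ, hgc, -⟩ := (Measure.integrable_toReal_rnDeriv (μ := ν)
    (ν := volume)).exists_hasCompactSupport_lintegral_sub_le (ε := ENNReal.ofReal δ)
    (by simpa using hδ0)
  obtain ⟨n, hn⟩ := exists_cylOsc hβ hp₁ hp₁' hgc hδ0
  set E : ℝ × ℝ → ℝ≥0∞ := fun q => ‖(h q).toReal - g q‖ₑ with hE
  have hEm : Measurable E := (hhm.ennreal_toReal.sub hgc.measurable).enorm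
  have hEle : ∫⁻ q in unitSquare, E q ≤ ENNReal.ofReal δ :=
    (setLIntegral_le_lintegral _ _).trans hgδ
  have hfin : ∀ᵐ q ∂(volume.restrict unitSquare), h q < ⊤ :=
    ae_restrict_of_ae (Measure.rnDeriv_lt_top ν volume)
  have hG : Measurable fun q => ENNReal.ofReal (g q) := hgc.measurable.ennreal_ofReal
  have hle1 : ∀ᵐ q ∂(volume.restrict unitSquare), h q ≤ ENNReal.ofReal (g q) + E q := by
    filter_upwards [hfin] with q hq
    nth_rw 1 [← ENNReal.ofReal_toReal hq.ne]
    rw [hE]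
    simp only
    rw [Real.enorm_eq_ofReal_abs]
    refine le_trans (ENNReal.ofReal_le_ofReal ?_) ENNReal.ofReal_add_le
    linarith [le_abs_self ((h q).toReal - g q)]
  have hle2 : ∀ᵐ q ∂(volume.restrict unitSquare), ENNReal.ofReal (g q) ≤ h q + E q := by
    filter_upwards [hfin] with q hq
    nth_rw 1 [← ENNReal.ofReal_toReal hq.ne]
    rw [hE]
    simp only
    rw [Real.enorm_eq_ofReal_abs]
    refine le_trans (ENNReal.ofReal_le_ofReal ?_) ENNReal.ofReal_add_le
    linarith [neg_abs_le ((h q).toReal - g q)]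
  have hdist := setLIntegral_iterate_le hα hαβ hp₁ hp₁' hB hBΔ n (fun q => ENNReal.ofReal (g q))
    (fun _ => 1) hG measurable_const (fun _ _ _ _ _ => le_rfl) hn
  simp only [mul_one] at hdist
  have hGint : ∫⁻ q in unitSquare, (ENNReal.ofReal (g q) + ENNReal.ofReal δ) ≤
      1 + ENNReal.ofReal δ + ENNReal.ofReal δ := by
    rw [lintegral_add_left hG, setLIntegral_const, volume_unitSquare, mul_one]
    gcongr
    refine (lintegral_mono_ae hle2).trans ?_
    rw [lintegral_add_left hhm]
    exact add_le_add hsq hEle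
  have hSn : Measurable (skewLSV α β p₁)^[n] := measurable_skewLSV.iterate n
  have hind : Measurable fun q => B.indicator (1 : ℝ × ℝ → ℝ≥0∞) ((skewLSV α β p₁)^[n] q) :=
    (measurable_one.indicator hB).comp hSn
  calc ν B = ν ((skewLSV α β p₁)^[n] ⁻¹' B) :=
        ((hmp.iterate n).measure_preimage hB.nullMeasurableSet).symm
    _ = ∫⁻ q in unitSquare, B.indicator 1 ((skewLSV α β p₁)^[n] q) * h q := hνA _ (hSn hB)
    _ ≤ ∫⁻ q in unitSquare, (B.indicator 1 ((skewLSV α β p₁)^[n] q) * ENNReal.ofReal (g q) +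
          E q) := by
        refine lintegral_mono_ae ?_
        filter_upwards [hle1] with q hq
        by_cases hqB : (skewLSV α β p₁)^[n] q ∈ B
        · simpa [hqB] using hq
        · simp [hqB]
    _ ≤ 2 * volume B * (1 + ENNReal.ofReal δ + ENNReal.ofReal δ) + ENNReal.ofReal δ := by
        rw [lintegral_add_right _ hEm]
        exact add_le_add (hdist.trans (by gcongr)) hEle
    _ = 2 * volume B + volume B * (4 * ENNReal.ofReal δ) + ENNReal.ofReal δ := by ring
    _ ≤ 2 * volume B + 1 * (4 * ENNReal.ofReal δ) + ENNReal.ofReal δ := by gcongr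
    _ = 2 * volume B + 5 * ENNReal.ofReal δ := by ring
    _ = 2 * volume B + ε := by
        congr 1
        rw [show (5 : ℝ≥0∞) = ENNReal.ofReal 5 by simp, ← ENNReal.ofReal_mul (by norm_num), hδ,
          mul_div_cancel₀ _ (by norm_num), ENNReal.ofReal_coe_nnreal]

end Density

section Orbits

variable {α β p₁ : ℝ}

/-- One application of the left branch decreases `x ^ (-b)` by at least `b / 2`. -/
lemma rpow_neg_lsv_add_le {a b x : ℝ} (ha : 0 < a) (hab : a ≤ b) (hb : b ≤ 1)
    (hx : x ∈ Ioc (0 : ℝ) (1 / 2)) : lsv a x ^ (-b) + b / 2 ≤ x ^ (-b) := by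
  obtain ⟨hx0, hx1⟩ := hx
  have hb0 : 0 < b := ha.trans_le hab
  set u : ℝ := 2 ^ a * x ^ a with hu
  have hu0 : 0 ≤ u := by positivity
  have hu1 : u ≤ 1 := by
    rw [hu, ← Real.mul_rpow (by norm_num) hx0.le]
    exact Real.rpow_le_one (by linarith) (by linarith) ha.le
  have hxb : 1 ≤ x ^ (-b) * u := by
    have h1 : x ^ (-a) ≤ x ^ (-b) :=
      Real.rpow_le_rpow_of_exponent_ge hx0 (by linarith) (by linarith)
    have h2 : x ^ (-a) * x ^ a = 1 := by
      rw [← Real.rpow_add hx0, neg_add_cancel, Real.rpow_zero]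
    have h3 : (1 : ℝ) ≤ 2 ^ a := Real.one_le_rpow (by norm_num) ha.le
    calc (1 : ℝ) ≤ 2 ^ a := h3
      _ = 2 ^ a * (x ^ (-a) * x ^ a) := by rw [h2, mul_one]
      _ = x ^ (-a) * u := by rw [hu]; ring
      _ ≤ _ := mul_le_mul_of_nonneg_right h1 hu0
  have hinv : (1 + u)⁻¹ ≤ 1 + -(u / 2) := by
    rw [inv_le_iff_one_le_mul₀ (by linarith)]
    nlinarith
  have hpow : (1 + u) ^ (-b) ≤ 1 + b * -(u / 2) := by
    rw [Real.rpow_neg (by linarith), ← Real.inv_rpow (by linarith)]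
    exact (Real.rpow_le_rpow (inv_nonneg.2 (by linarith)) hinv hb0.le).trans
      (rpow_one_add_le_one_add_mul_self (by linarith) hb0.le hb)
  have hl : lsv a x = x * (1 + u) := by rw [lsv, if_pos hx1]
  rw [hl, Real.mul_rpow hx0.le (by linarith)]
  have hxb0 : 0 < x ^ (-b) := Real.rpow_pos_of_pos hx0 _
  nlinarith [mul_le_mul_of_nonneg_left hpow hxb0.le]

lemma sum_range_rpow_neg_le {s : ℝ} (hs0 : 0 ≤ s) (hs : s < 1) (n : ℕ) :
    ∑ j ∈ Finset.range n, ((j : ℝ) + 1) ^ (-s) ≤ (n : ℝ) ^ (1 - s) / (1 - s) := by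
  rw [le_div_iff₀ (by linarith)]
  induction n with
  | zero => simp [Real.zero_rpow (by linarith : 1 - s ≠ 0)]
  | succ n ih =>
    have hn : (0 : ℝ) < n + 1 := by positivity
    have key : (n : ℝ) ^ (1 - s) ≤
        ((n : ℝ) + 1) ^ (1 - s) - (1 - s) * ((n : ℝ) + 1) ^ (-s) := by
      have hB := rpow_one_add_le_one_add_mul_self (s := -((n : ℝ) + 1)⁻¹) (p := 1 - s)
        (by
          have : ((n : ℝ) + 1)⁻¹ ≤ 1 := inv_le_one_of_one_le₀ (by linarith [n.cast_nonneg (α := ℝ)])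
          linarith) (by linarith) (by linarith)
      have e : (n : ℝ) = ((n : ℝ) + 1) * (1 + -((n : ℝ) + 1)⁻¹) := by field_simp; ring
      have hnn : 0 ≤ 1 + -((n : ℝ) + 1)⁻¹ := by
        have : ((n : ℝ) + 1)⁻¹ ≤ 1 := inv_le_one_of_one_le₀ (by linarith [n.cast_nonneg (α := ℝ)])
        linarith
      have e2 : ((n : ℝ) + 1) ^ (1 - s) = ((n : ℝ) + 1) * ((n : ℝ) + 1) ^ (-s) := by
        rw [sub_eq_add_neg, Real.rpow_add hn, Real.rpow_one]
      calc (n : ℝ) ^ (1 - s) = ((n : ℝ) + 1) ^ (1 - s) * (1 + -((n : ℝ) + 1)⁻¹) ^ (1 - s) := by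
            rw [← Real.mul_rpow hn.le hnn, ← e]
        _ ≤ ((n : ℝ) + 1) ^ (1 - s) * (1 + (1 - s) * -((n : ℝ) + 1)⁻¹) := by gcongr
        _ = _ := by rw [e2]; field_simp; ring
    rw [Finset.sum_range_succ, add_mul]
    push_cast
    linarith

/-- If `x k ^ (-b)` decreases by at least `c` at each step, then `∑ x k ^ g` is at most of order
`n ^ (1 - g / b)`. -/
lemma sum_rpow_le {x : ℕ → ℝ} {b c g : ℝ} {n : ℕ} (hb : 0 < b) (hc : 0 < c) (hg : 0 < g)
    (hgb : g < b) (hx : ∀ k, x k ∈ Ioc (0 : ℝ) 1)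
    (hstep : ∀ k, 1 ≤ k → k < n → x (k + 1) ^ (-b) + c ≤ x k ^ (-b)) (hn : 1 ≤ n) :
    ∑ k ∈ Finset.range n, x k ^ g ≤ (1 + c ^ (-(g / b)) / (1 - g / b)) * (n : ℝ) ^ (1 - g / b) := by
  obtain ⟨N, rfl⟩ := Nat.exists_eq_add_of_le' hn
  have hs1 : g / b < 1 := (div_lt_one hb).2 hgb
  have hs0 : 0 < g / b := div_pos hg hb
  have hlow : ∀ j, j ≤ N → c * j ≤ x (N + 1 - j) ^ (-b) := by
    intro j
    induction j with
    | zero => intro _; simpa using Real.rpow_nonneg (hx _).1.le _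
    | succ j ih =>
      intro hj
      have h1 := hstep (N + 1 - (j + 1)) (by omega) (by omega)
      rw [show N + 1 - (j + 1) + 1 = N + 1 - j by omega] at h1
      refine le_trans ?_ h1
      have h2 := ih (by omega)
      push_cast
      linarith
  have hterm : ∀ j ∈ Finset.range N, x (N - 1 - j + 1) ^ g ≤
      c ^ (-(g / b)) * ((j : ℝ) + 1) ^ (-(g / b)) := by
    intro j hj
    have hj' := Finset.mem_range.1 hj
    have h := hlow (j + 1) (by omega)
    rw [show N + 1 - (j + 1) = N - 1 - j + 1 by omega] at h
    push_cast at h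
    have hpos : 0 < c * ((j : ℝ) + 1) := by positivity
    have hxp := (hx (N - 1 - j + 1)).1
    have h2 := Real.rpow_le_rpow_of_nonpos hpos h (by linarith : -(g / b) ≤ 0)
    rw [← Real.rpow_mul hxp.le, Real.mul_rpow hc.le (by positivity)] at h2
    rwa [show -b * -(g / b) = g by field_simp] at h2
  have hone : (1 : ℝ) ≤ ((N + 1 : ℕ) : ℝ) ^ (1 - g / b) :=
    Real.one_le_rpow (by push_cast; linarith [N.cast_nonneg (α := ℝ)]) (by linarith)
  have hmono : (N : ℝ) ^ (1 - g / b) ≤ ((N + 1 : ℕ) : ℝ) ^ (1 - g / b) :=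
    Real.rpow_le_rpow (by positivity) (by push_cast; linarith) (by linarith)
  have hcb : 0 ≤ c ^ (-(g / b)) := Real.rpow_nonneg hc.le _
  rw [Finset.sum_range_succ', ← Finset.sum_range_reflect (fun k => x (k + 1) ^ g)]
  calc ∑ j ∈ Finset.range N, x (N - 1 - j + 1) ^ g + x 0 ^ g
      ≤ ∑ j ∈ Finset.range N, c ^ (-(g / b)) * ((j : ℝ) + 1) ^ (-(g / b)) + 1 := by
        gcongr with j hj
        · exact hterm j hj
        · exact Real.rpow_le_one (hx 0).1.le (hx 0).2 hg.le
    _ ≤ c ^ (-(g / b)) * (((N + 1 : ℕ) : ℝ) ^ (1 - g / b) / (1 - g / b)) +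
          ((N + 1 : ℕ) : ℝ) ^ (1 - g / b) := by
        rw [← Finset.mul_sum]
        gcongr
        refine (sum_range_rpow_neg_le hs0.le hs1 N).trans ?_
        gcongr
    _ = _ := by ring

lemma skewLSV_iterate_snd (p : ℝ × ℝ) (k : ℕ) :
    ((skewLSV α β p₁)^[k] p).2 = (phiMap p₁)^[k] p.2 := by
  induction k with
  | zero => rfl
  | succ k ih => rw [Function.iterate_succ_apply', Function.iterate_succ_apply', ← ih, skewLSV]

lemma skewLSV_iterate_fst_succ (p : ℝ × ℝ) (k : ℕ) :
    ((skewLSV α β p₁)^[k + 1] p).1 =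
      lsv (alphaOf α β p₁ ((phiMap p₁)^[k] p.2)) ((skewLSV α β p₁)^[k] p).1 := by
  rw [Function.iterate_succ_apply', ← skewLSV_iterate_snd (α := α) (β := β), skewLSV]

lemma skewLSV_iterate_fst_mem (hα : 0 < α) (hαβ : α < β) {p : ℝ × ℝ} (hp : p.1 ∈ Ioc (0 : ℝ) 1)
    (k : ℕ) : ((skewLSV α β p₁)^[k] p).1 ∈ Ioc (0 : ℝ) 1 := by
  induction k with
  | zero => exact hp
  | succ k ih => rw [skewLSV_iterate_fst_succ]; exact lsv_mem_Ioc (alphaOf_pos hα hαβ _) ih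

lemma skewLSV_iterate_fst_le_half (hα : 0 < α) (hαβ : α < β) (hp₁ : 0 < p₁) (hp₁' : p₁ < 1)
    {p : ℝ × ℝ} (hp : p ∈ Δ0) {k : ℕ} (hk : 1 ≤ k) (hkn : k < retTime α β p₁ p) :
    ((skewLSV α β p₁)^[k] p).1 ∈ Ioc (0 : ℝ) (1 / 2) := by
  have hm := skewLSV_iterate_fst_mem (p₁ := p₁) hα hαβ
    (⟨by linarith [hp.1.1], hp.1.2⟩ : p.1 ∈ Ioc (0 : ℝ) 1) k
  refine ⟨hm.1, not_lt.1 fun h => Nat.notMem_of_lt_sInf hkn ⟨hk, ⟨h, hm.2⟩, ?_⟩⟩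
  rw [skewLSV_iterate_snd]
  exact phiMap_iterate_mem_Icc hp₁ hp₁' hp.2 k

/-- The centred indicator of the branch with parameter `α`. -/
def centredLeft (p₁ ω : ℝ) : ℝ := (if ω < p₁ then 1 else 0) - p₁

lemma measurable_centredLeft : Measurable (centredLeft p₁) :=
  (Measurable.ite measurableSet_Iio measurable_const measurable_const).sub measurable_const

lemma abs_centredLeft_le (hp₁ : 0 < p₁) (hp₁' : p₁ < 1) (ω : ℝ) : |centredLeft p₁ ω| ≤ 1 := by
  rw [centredLeft, abs_le]
  split_ifs <;> constructor <;> linarith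

lemma centredLeft_average (hp₁ : 0 < p₁) (hp₁' : p₁ < 1) {ω : ℝ} (hω : ω ∈ Ico (0 : ℝ) 1) :
    p₁ * centredLeft p₁ (p₁ * ω) + (1 - p₁) * centredLeft p₁ (p₁ + (1 - p₁) * ω) = 0 := by
  have h1 : p₁ * ω < p₁ := by nlinarith [hω.2]
  have h2 : ¬ p₁ + (1 - p₁) * ω < p₁ := by nlinarith [hω.1]
  rw [centredLeft, centredLeft, if_pos h1, if_neg h2]
  ring

/-- The return time is bounded by a power of the first entry point, up to the deviation of the
number of visits to the branch with parameter `α`. -/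
lemma mul_retTime_add_birkhoffSum_le (hα : 0 < α) (hαβ : α < β) (hβ : β < 1) (hp₁ : 0 < p₁)
    (hp₁' : p₁ < 1) {p : ℝ × ℝ} (hp : p ∈ Δ0) (hn : 1 ≤ retTime α β p₁ p) :
    α / 2 * (birkhoffSum (phiMap p₁) (centredLeft p₁) (retTime α β p₁ p) p.2 +
      retTime α β p₁ p * p₁ - 1) ≤ (2 * p.1 - 1) ^ (-α) := by
  set n := retTime α β p₁ p with hnd
  set x : ℕ → ℝ := fun k => ((skewLSV α β p₁)^[k] p).1 with hx
  have hxm : ∀ k, x k ∈ Ioc (0 : ℝ) 1 := fun k => skewLSV_iterate_fst_mem hα hαβ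
    ⟨by linarith [hp.1.1], hp.1.2⟩ k
  have hx1 : x 1 = 2 * p.1 - 1 := by
    simp only [hx, Function.iterate_one, skewLSV]
    exact lsv_of_lt hp.1.1
  have hstep : ∀ k, 1 ≤ k → k < n → x (k + 1) ^ (-α) +
      α / 2 * (centredLeft p₁ ((phiMap p₁)^[k] p.2) + p₁) ≤ x k ^ (-α) := by
    intro k hk hkn
    have hk2 := skewLSV_iterate_fst_le_half hα hαβ hp₁ hp₁' hp hk hkn
    have e : x (k + 1) = lsv (alphaOf α β p₁ ((phiMap p₁)^[k] p.2)) (x k) :=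
      skewLSV_iterate_fst_succ p k
    by_cases hω : (phiMap p₁)^[k] p.2 < p₁
    · rw [e, alphaOf, centredLeft, if_pos hω, if_pos hω, sub_add_cancel, mul_one]
      exact rpow_neg_lsv_add_le hα le_rfl (by linarith) hk2
    · rw [e, alphaOf, centredLeft, if_neg hω, if_neg hω, sub_add_cancel, mul_zero, add_zero,
        lsv_of_le hk2.1.le hk2.2]
      exact Real.rpow_le_rpow_of_nonpos hk2.1 (le_leftBranch hk2.1.le) (by linarith)
  have hsum : ∀ j, 1 ≤ j → j ≤ n → α / 2 * (birkhoffSum (phiMap p₁) (centredLeft p₁) j p.2 +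
      j * p₁ - 1) ≤ x 1 ^ (-α) - x j ^ (-α) := by
    intro j hj
    induction j, hj using Nat.le_induction with
    | base =>
      intro _
      rw [birkhoffSum_one, sub_self]
      have : centredLeft p₁ p.2 + p₁ ≤ 1 := by
        rw [centredLeft, sub_add_cancel]; split_ifs <;> norm_num
      push_cast
      nlinarith
    | succ j hj ih =>
      intro hjn
      have h1 := ih (by omega)
      have h2 := hstep j hj (by omega)
      rw [birkhoffSum_succ]
      push_cast
      linarith
  have h := hsum n hn le_rfl
  have h0 : 0 ≤ x n ^ (-α) := Real.rpow_nonneg (hxm n).1.le _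
  rw [hx1] at h
  linarith

/-- Sublinear powers are eventually dominated by any linear function. -/
lemma exists_rpow_le_mul_add {σ d : ℝ} (hσ0 : 0 ≤ σ) (hσ : σ < 1) (hd : 0 < d) :
    ∃ K : ℝ, 0 ≤ K ∧ ∀ n : ℕ, (n : ℝ) ^ σ ≤ d * n + K := by
  refine ⟨(d⁻¹ ^ (1 - σ)⁻¹) ^ σ, by positivity, fun n => ?_⟩
  set L : ℝ := d⁻¹ ^ (1 - σ)⁻¹ with hL
  have hL0 : 0 < L := by positivity
  rcases le_or_gt (n : ℝ) L with h | h
  · have := Real.rpow_le_rpow (by positivity) h hσ0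
    have : 0 ≤ d * n := by positivity
    linarith
  · have hn : (0 : ℝ) < n := hL0.trans h
    have h1 : d⁻¹ ≤ (n : ℝ) ^ (1 - σ) := by
      have := Real.rpow_le_rpow hL0.le h.le (by linarith : 0 ≤ 1 - σ)
      rwa [hL, ← Real.rpow_mul (by positivity), inv_mul_cancel₀ (by linarith), Real.rpow_one]
        at this
    have h2 : (n : ℝ) ^ σ * (n : ℝ) ^ (1 - σ) = n := by
      rw [← Real.rpow_add hn]; simp
    have h3 : (n : ℝ) ^ σ ≤ d * n := by
      have h4 : 0 ≤ (n : ℝ) ^ σ := by positivity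
      have := mul_le_mul_of_nonneg_left h1 h4
      rw [h2, ← div_eq_mul_inv, div_le_iff₀ hd] at this
      linarith
    have : 0 ≤ L ^ σ := by positivity
    linarith

end Orbits

section Integrability

variable {α β p₁ : ℝ}

lemma setLIntegral_Δ0_mul {F G : ℝ → ℝ≥0∞} (hF : Measurable F) (hG : Measurable G) :
    ∫⁻ z in Δ0, F z.1 * G z.2 =
      (∫⁻ x in Ioc (1 / 2 : ℝ) 1, F x) * ∫⁻ ω in Ico (0 : ℝ) 1, G ω := by
  rw [Δ0, Measure.volume_eq_prod, ← Measure.prod_restrict,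
    lintegral_prod_mul hF.aemeasurable hG.aemeasurable, Measure.restrict_congr_set Ico_ae_eq_Icc]

lemma setLIntegral_Δ0_rpow_lt_top {κ K : ℝ} (hκ : κ < 1) :
    ∫⁻ z in Δ0, ENNReal.ofReal (K * (2 * z.1 - 1) ^ (-κ)) < ⊤ := by
  have hint : IntervalIntegrable (fun x : ℝ => K * (2 * x - 1) ^ (-κ)) volume (1 / 2) 1 := by
    have h1 : IntervalIntegrable (fun x : ℝ => x ^ (-κ)) volume 0 1 :=
      intervalIntegral.intervalIntegrable_rpow' (by linarith)
    have h2 := (h1.comp_sub_right 1).comp_mul_left (c := 2)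
    norm_num at h2
    exact h2.const_mul K
  have hlt := ((intervalIntegrable_iff_integrableOn_Ioc_of_le (by norm_num)).1 hint).lintegral_lt_top
  have hm : Measurable fun x : ℝ => ENNReal.ofReal (K * (2 * x - 1) ^ (-κ)) := by fun_prop
  have h := setLIntegral_Δ0_mul hm (measurable_const (a := (1 : ℝ≥0∞)))
  simp only [mul_one] at h
  rw [h]
  exact ENNReal.mul_lt_top hlt (by simp)

lemma setLIntegral_Δ0_tsum_lt_top {D : ℕ → Set ℝ} (hD : ∀ n, MeasurableSet (D n)) {F q : ℝ}
    (hF : 0 ≤ F)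
    (h : ∑' n : ℕ, ENNReal.ofReal ((n : ℝ) ^ q) * volume.restrict (Ico (0 : ℝ) 1) (D n) < ⊤) :
    ∫⁻ z in Δ0, ∑' n : ℕ, ENNReal.ofReal (F * (n : ℝ) ^ q) * (D n).indicator 1 z.2 < ⊤ := by
  have hm : ∀ n : ℕ, Measurable fun ω : ℝ =>
      ENNReal.ofReal (F * (n : ℝ) ^ q) * (D n).indicator (1 : ℝ → ℝ≥0∞) ω := fun n =>
    (measurable_one.indicator (hD n)).const_mul _
  have e := setLIntegral_Δ0_mul (measurable_const (a := (1 : ℝ≥0∞)))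
    (Measurable.tsum (L := SummationFilter.unconditional ℕ) hm)
  simp only [one_mul] at e
  rw [e, lintegral_tsum fun n => (hm n).aemeasurable]
  refine ENNReal.mul_lt_top (by simp) ?_
  simp_rw [lintegral_const_mul _ (measurable_one.indicator (hD _)), lintegral_indicator_one (hD _),
    ENNReal.ofReal_mul hF, mul_assoc, ENNReal.tsum_mul_left]
  exact ENNReal.mul_lt_top ENNReal.ofReal_lt_top h

/-- The values of `f` along the noise are a bounded perturbation of a martingale difference. -/
lemma exists_martingale_bound (hp₁ : 0 < p₁) (hp₁' : p₁ < 1) {f : ℝ × ℝ → ℝ} {C t : ℝ}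
    (ht : 0 < t)
    (hf : ∀ p ∈ Icc (0 : ℝ) 1 ×ˢ Icc (0 : ℝ) 1, ∀ q ∈ Icc (0 : ℝ) 1 ×ˢ Icc (0 : ℝ) 1,
      |f p - f q| ≤ C * dist p q ^ t)
    (hc : (∫ ω in Icc (0 : ℝ) 1, f (0, ω)) = 0) :
    ∃ (m : ℝ → ℝ) (M : ℝ), Measurable m ∧ 0 ≤ M ∧ (∀ ω ∈ Icc (0 : ℝ) 1, |m ω| ≤ M) ∧
      (∀ ω ∈ Ico (0 : ℝ) 1, p₁ * m (p₁ * ω) + (1 - p₁) * m (p₁ + (1 - p₁) * ω) = 0) ∧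
      ∀ ω ∈ Icc (0 : ℝ) 1, ∀ n : ℕ, |∑ k ∈ Finset.range n, f (0, (phiMap p₁)^[k] ω)| ≤
        |birkhoffSum (phiMap p₁) m n ω| + 2 * M := by
  have h01 : (0 : ℝ) ≤ 1 := zero_le_one
  have hC0 : 0 ≤ C := by
    have h := hf (0, 0) ⟨by simp, by simp⟩ (0, 1) ⟨by simp, by simp⟩
    have hd : dist ((0 : ℝ), (0 : ℝ)) (0, 1) = 1 := by simp [Prod.dist_eq]
    rw [hd, Real.one_rpow, mul_one] at h
    exact (abs_nonneg _).trans h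
  set g : ℝ → ℝ := fun ω => f (0, projIcc 0 1 h01 ω) with hg
  have hgC : ∀ x y, |g x - g y| ≤ C * |x - y| ^ t := by
    intro x y
    refine (hf _ ⟨by simp, (projIcc 0 1 h01 x).2⟩ _ ⟨by simp, (projIcc 0 1 h01 y).2⟩).trans ?_
    gcongr
    rw [Prod.dist_eq, dist_self, max_eq_right dist_nonneg, Real.dist_eq]
    exact abs_projIcc_sub_projIcc h01
  have hgcont : Continuous g := by
    rw [continuous_iff_continuousAt]
    intro x
    rw [ContinuousAt, tendsto_iff_dist_tendsto_zero]
    have hlim : Tendsto (fun y : ℝ => C * |y - x| ^ t) (𝓝 x) (𝓝 0) := by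
      have : Continuous fun y : ℝ => C * |y - x| ^ t := by
        have := ht.le
        fun_prop (disch := assumption)
      simpa [Real.zero_rpow ht.ne'] using this.tendsto x
    exact squeeze_zero (fun _ => dist_nonneg) (fun y => (hgC y x)) hlim
  have hgeq : ∀ ω ∈ Icc (0 : ℝ) 1, g ω = f (0, ω) := fun ω hω => by
    rw [hg]; simp only; rw [projIcc_of_mem h01 hω]
  have hg0 : ∫ ω in (0 : ℝ)..1, g ω = 0 := by
    rw [intervalIntegral.integral_of_le h01, ← integral_Icc_eq_integral_Ioc]
    exact (setIntegral_congr_fun measurableSet_Icc hgeq).trans hc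
  obtain ⟨χ, m, M, hm, hmM, hχM, hm0, hgm⟩ :=
    exists_martingale_coboundary hp₁ hp₁' hgcont hg0 hC0 ht hgC
  refine ⟨m, M, hm, (abs_nonneg _).trans (hmM 0 (by simp)), hmM, hm0, fun ω hω n => ?_⟩
  have hsum : ∀ n : ℕ, ∑ k ∈ Finset.range n, f (0, (phiMap p₁)^[k] ω) =
      birkhoffSum (phiMap p₁) m n ω + (χ ((phiMap p₁)^[n] ω) - χ ω) := by
    intro n
    induction n with
    | zero => simp
    | succ n ih =>
      rw [Finset.sum_range_succ, ih, birkhoffSum_succ,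
        ← hgeq _ (phiMap_iterate_mem_Icc hp₁ hp₁' hω n), hgm, Function.iterate_succ_apply']
      ring
  rw [hsum]
  refine (abs_add_le _ _).trans ?_
  gcongr
  refine (abs_sub _ _).trans ?_
  linarith [hχM _ (phiMap_iterate_mem_Icc hp₁ hp₁' hω n), hχM _ hω]

/-- Away from the deviation set of the branch count, the return time is at most of order
`(2 x - 1) ^ (-α)`. -/
lemma exists_retTime_le (hα : 0 < α) (hαβ : α < β) (hβ : β < 1) (hp₁ : 0 < p₁) (hp₁' : p₁ < 1)
    {ε : ℝ} (hε : 0 < ε) (hε' : ε < 1 / 2) :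
    ∃ K : ℝ, 0 < K ∧ ∀ z ∈ Δ0,
      z.2 ∉ deviationSet p₁ (centredLeft p₁) ε (retTime α β p₁ z) →
      (retTime α β p₁ z : ℝ) ≤ K * (2 * z.1 - 1) ^ (-α) := by
  obtain ⟨L, hL0, hL⟩ := exists_rpow_le_mul_add (σ := 1 / 2 + ε) (d := p₁ / 2) (by linarith)
    (by linarith) (by linarith)
  refine ⟨2 / p₁ * (2 / α + L + 1), by positivity, fun z hz hω => ?_⟩
  have hX : 1 ≤ (2 * z.1 - 1) ^ (-α) :=
    Real.one_le_rpow_of_pos_of_le_one_of_nonpos (by linarith [hz.1.1]) (by linarith [hz.1.2])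
      (by linarith)
  rcases Nat.eq_zero_or_pos (retTime α β p₁ z) with h0 | hn
  · rw [h0]; push_cast; positivity
  have h1 := mul_retTime_add_birkhoffSum_le hα hαβ hβ hp₁ hp₁' hz hn
  set n := retTime α β p₁ z
  set X := (2 * z.1 - 1) ^ (-α)
  rw [deviationSet, mem_ofPred_eq, not_lt] at hω
  have h2 := (abs_le.1 (hω.trans (hL n))).1
  have h3 : (n : ℝ) * (p₁ / 2) ≤ 2 / α * X + L + 1 := by
    have : birkhoffSum (phiMap p₁) (centredLeft p₁) n z.2 + n * p₁ - 1 ≤ 2 / α * X := by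
      rw [div_mul_eq_mul_div, le_div_iff₀ hα]; linarith
    linarith
  have h4 : 2 / α * X + L + 1 ≤ (2 / α + L + 1) * X := by nlinarith
  calc (n : ℝ) = 2 / p₁ * (n * (p₁ / 2)) := by field_simp
    _ ≤ 2 / p₁ * ((2 / α + L + 1) * X) := mul_le_mul_of_nonneg_left (h3.trans h4) (by positivity)
    _ = _ := by ring

/-- Polynomial bound for the induced observable in terms of the return time. -/
lemma abs_inducedObs_le (hα : 0 < α) (hαβ : α < β) (hβ : β < 1) (hp₁ : 0 < p₁) (hp₁' : p₁ < 1)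
    {f : ℝ × ℝ → ℝ} {γ Cf : ℝ} (hγ0 : 0 < γ) (hγβ : γ < β)
    (hreg : ∀ x ∈ Icc (0 : ℝ) 1, ∀ ω ∈ Icc (0 : ℝ) 1, |f (x, ω) - f (0, ω)| ≤ Cf * x ^ γ)
    {z : ℝ × ℝ} (hz : z ∈ Δ0) (hn : 1 ≤ retTime α β p₁ z) :
    |inducedObs α β p₁ f z| ≤
      |∑ k ∈ Finset.range (retTime α β p₁ z), f (0, (phiMap p₁)^[k] z.2)| +
        Cf * (1 + (β / 2) ^ (-(γ / β)) / (1 - γ / β)) * (retTime α β p₁ z : ℝ) ^ (1 - γ / β) := by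
  set n := retTime α β p₁ z
  set x : ℕ → ℝ := fun k => ((skewLSV α β p₁)^[k] z).1 with hx
  have hβ0 : 0 < β := hα.trans hαβ
  have hxm : ∀ k, x k ∈ Ioc (0 : ℝ) 1 := fun k => skewLSV_iterate_fst_mem hα hαβ
    ⟨by linarith [hz.1.1], hz.1.2⟩ k
  have hCf : 0 ≤ Cf := by
    have := (abs_nonneg _).trans (hreg 1 (by simp) 0 (by simp))
    simpa using this
  have hsum := sum_rpow_le hβ0 (half_pos hβ0) hγ0 hγβ hxm (fun k hk hkn => by
    rw [hx]
    simp only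
    rw [skewLSV_iterate_fst_succ]
    exact rpow_neg_lsv_add_le (alphaOf_pos hα hαβ _) (alphaOf_le hαβ _) hβ.le
      (skewLSV_iterate_fst_le_half hα hαβ hp₁ hp₁' hz hk hkn)) hn
  have hsplit : inducedObs α β p₁ f z =
      ∑ k ∈ Finset.range n, f (0, (phiMap p₁)^[k] z.2) +
        ∑ k ∈ Finset.range n,
          (f (x k, (phiMap p₁)^[k] z.2) - f (0, (phiMap p₁)^[k] z.2)) := by
    rw [Finset.sum_sub_distrib, add_sub_cancel, inducedObs]
    refine Finset.sum_congr rfl fun k _ => ?_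
    rw [hx, ← skewLSV_iterate_snd (α := α) (β := β)]
  rw [hsplit]
  refine (abs_add_le _ _).trans (add_le_add_right ?_ _)
  calc |∑ k ∈ Finset.range n, (f (x k, (phiMap p₁)^[k] z.2) - f (0, (phiMap p₁)^[k] z.2))|
      ≤ ∑ k ∈ Finset.range n, Cf * x k ^ γ :=
        (Finset.abs_sum_le_sum_abs _ _).trans (Finset.sum_le_sum fun k _ =>
          hreg _ (Ioc_subset_Icc_self (hxm k)) _ (phiMap_iterate_mem_Icc hp₁ hp₁' hz.2 k))
    _ ≤ _ := by
        rw [← Finset.mul_sum, mul_assoc]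
        gcongr

end Integrability
/-- Lemma 3.5: `f_{Δ₀} ∈ L^p(Δ₀, ν)` for
`1 ≤ p < min{2/α, 1/(α(1 − γ/β))}` when `E_ω(f(0,ω)) = 0` and `|f(x,ω) − f(0,ω)| ≤ C_f x^γ`. -/
theorem induced_obs_Lp (α β p₁ : ℝ) (hα : 0 < α) (hαβ : α < β) (hβ : β < 1)
    (hp₁ : 0 < p₁) (hp₁' : p₁ < 1)
    (ν : Measure (ℝ × ℝ)) (hprob : IsProbabilityMeasure ν)
    (hac : ν ≪ (volume : Measure (ℝ × ℝ)))
    (hsupp : ν ((Icc (0 : ℝ) 1 ×ˢ Icc (0 : ℝ) 1)ᶜ) = 0)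
    (hinv : ∀ A : Set (ℝ × ℝ), MeasurableSet A → ν (skewLSV α β p₁ ⁻¹' A) = ν A)
    (f : ℝ × ℝ → ℝ)
    (hf : ∃ C t : ℝ, 0 < t ∧ t ≤ 1 ∧
      ∀ p ∈ Icc (0 : ℝ) 1 ×ˢ Icc (0 : ℝ) 1, ∀ q ∈ Icc (0 : ℝ) 1 ×ˢ Icc (0 : ℝ) 1,
        |f p - f q| ≤ C * dist p q ^ t)
    (hc : (∫ ω in Icc (0 : ℝ) 1, f (0, ω)) = 0)
    (γ Cf : ℝ) (hγ0 : 0 < γ) (hγβ : γ < β)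
    (hreg : ∀ x ∈ Icc (0 : ℝ) 1, ∀ ω ∈ Icc (0 : ℝ) 1, |f (x, ω) - f (0, ω)| ≤ Cf * x ^ γ) :
    ∀ q : ℝ, 1 ≤ q → q < min (2 / α) (1 / (α * (1 - γ / β))) →
      (∫⁻ p in Δ0, ENNReal.ofReal (|inducedObs α β p₁ f p| ^ q) ∂ν) < ⊤ := by
  intro q hq hqlt
  obtain ⟨hq1, hq2⟩ := lt_min_iff.1 hqlt
  have hβ0 : 0 < β := hα.trans hαβ
  have hq0 : 0 < q := by linarith
  have hs1 : γ / β < 1 := (div_lt_one hβ0).2 hγβ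
  have hs0 : 0 < γ / β := div_pos hγ0 hβ0
  rw [lt_div_iff₀ hα] at hq1
  rw [lt_div_iff₀ (mul_pos hα (by linarith))] at hq2
  obtain ⟨ε, hε, hε', hεq⟩ : ∃ ε : ℝ, 0 < ε ∧ ε < 1 / 2 ∧ q * α * (1 / 2 + ε) < 1 := by
    have hqα : 0 < q * α := mul_pos hq0 hα
    have hlt : 0 < min (1 / 2) ((q * α)⁻¹ - 1 / 2) := by
      refine lt_min (by norm_num) (sub_pos.2 ?_)
      rw [lt_inv_comm₀ (by norm_num) hqα]
      linarith
    obtain ⟨ε, h1, h2⟩ := exists_between hlt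
    obtain ⟨h3, h4⟩ := lt_min_iff.1 h2
    refine ⟨ε, h1, h3, ?_⟩
    have := mul_lt_mul_of_pos_left (by linarith : 1 / 2 + ε < (q * α)⁻¹) hqα
    rwa [mul_inv_cancel₀ hqα.ne'] at this
  set θ : ℝ := max (1 / 2 + ε) (1 - γ / β) with hθ
  have hθ0 : 0 < θ := lt_max_of_lt_left (by linarith)
  have hκ : α * (θ * q) < 1 := by
    rcases max_choice (1 / 2 + ε) (1 - γ / β) with h | h <;> rw [hθ, h] <;> linarith
  obtain ⟨C, t, ht, -, hC⟩ := hf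
  obtain ⟨m, M, hm, hM0, hmM, hm0, hmf⟩ := exists_martingale_bound hp₁ hp₁' ht hC hc
  obtain ⟨K, hK0, hK⟩ := exists_retTime_le hα hαβ hβ hp₁ hp₁' hε hε'
  have hCf : 0 ≤ Cf := by
    have := (abs_nonneg _).trans (hreg 1 (by simp) 0 (by simp))
    simpa using this
  set A : ℝ := 1 + 2 * M + Cf * (1 + (β / 2) ^ (-(γ / β)) / (1 - γ / β)) with hA
  have hA' : 0 ≤ Cf * (1 + (β / 2) ^ (-(γ / β)) / (1 - γ / β)) :=
    mul_nonneg hCf (add_nonneg zero_le_one (div_nonneg (by positivity) (by linarith)))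
  have hA0 : 0 < A := by linarith
  set F : ℝ := |f (0, 0)| + |C| with hF
  have hfF : ∀ z ∈ Icc (0 : ℝ) 1 ×ˢ Icc (0 : ℝ) 1, |f z| ≤ F := by
    intro z hz
    have h1 := hC z hz (0, 0) ⟨by simp, by simp⟩
    have hd : dist z (0, 0) ≤ 1 := by
      rw [Prod.dist_eq, Real.dist_eq, Real.dist_eq, sub_zero, sub_zero, abs_of_nonneg hz.1.1,
        abs_of_nonneg hz.2.1]
      exact max_le hz.1.2 hz.2.2
    have h2 : C * dist z (0, 0) ^ t ≤ |C| :=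
      (mul_le_mul_of_nonneg_right (le_abs_self C) (by positivity)).trans
        (mul_le_of_le_one_right (abs_nonneg _) (Real.rpow_le_one dist_nonneg hd ht.le))
    have h3 := abs_sub_abs_le_abs_sub (f z) (f (0, 0))
    linarith
  have hF0 : 0 ≤ F := by positivity
  set D₁ : ℕ → Set ℝ := deviationSet p₁ m ε
  set D₂ : ℕ → Set ℝ := deviationSet p₁ (centredLeft p₁) ε
  have hD₁ : ∀ n, MeasurableSet (D₁ n) := measurableSet_deviationSet hm ε
  have hD₂ : ∀ n, MeasurableSet (D₂ n) := measurableSet_deviationSet measurable_centredLeft ε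
  set B₀ : ℝ × ℝ → ℝ≥0∞ := fun z =>
    ENNReal.ofReal (A ^ q * K ^ (θ * q) * (2 * z.1 - 1) ^ (-(α * (θ * q))))
  set B₁ : ℝ × ℝ → ℝ≥0∞ := fun z =>
    ∑' n : ℕ, ENNReal.ofReal (F ^ q * (n : ℝ) ^ q) * (D₁ n).indicator 1 z.2
  set B₂ : ℝ × ℝ → ℝ≥0∞ := fun z =>
    ∑' n : ℕ, ENNReal.ofReal (F ^ q * (n : ℝ) ^ q) * (D₂ n).indicator 1 z.2
  have hB₀m : Measurable B₀ := by fun_prop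
  have hB₁m : Measurable B₁ := Measurable.tsum (L := SummationFilter.unconditional ℕ) fun n =>
    ((measurable_one.indicator (hD₁ n)).comp measurable_snd).const_mul _
  have hmΔ : MeasurableSet Δ0 := measurableSet_Ioc.prod measurableSet_Icc
  have hpt : ∀ z ∈ Δ0, ENNReal.ofReal (|inducedObs α β p₁ f z| ^ q) ≤ B₀ z + B₁ z + B₂ z := by
    intro z hz
    have hx0 : 0 < 2 * z.1 - 1 := by linarith [hz.1.1]
    rcases Nat.eq_zero_or_pos (retTime α β p₁ z) with h0 | hn
    · rw [inducedObs, h0, Finset.range_zero, Finset.sum_empty, abs_zero, Real.zero_rpow hq0.ne',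
        ENNReal.ofReal_zero]
      exact zero_le
    have hobs := abs_inducedObs_le hα hαβ hβ hp₁ hp₁' hγ0 hγβ hreg hz hn
    have hret := hK z hz
    set n := retTime α β p₁ z with hnd
    have hn1 : (1 : ℝ) ≤ n := by exact_mod_cast hn
    have hbad : ENNReal.ofReal (|inducedObs α β p₁ f z| ^ q) ≤
        ENNReal.ofReal (F ^ q * (n : ℝ) ^ q) := by
      rw [← Real.mul_rpow hF0 (by positivity)]
      refine ENNReal.ofReal_le_ofReal (Real.rpow_le_rpow (abs_nonneg _) ?_ hq0.le)
      rw [inducedObs, ← hnd]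
      refine (Finset.abs_sum_le_sum_abs _ _).trans ((Finset.sum_le_card_nsmul _ _ F
        fun k _ => hfF _ ⟨?_, ?_⟩).trans_eq ?_)
      · exact Ioc_subset_Icc_self
          (skewLSV_iterate_fst_mem hα hαβ ⟨by linarith [hz.1.1], hz.1.2⟩ k)
      · rw [skewLSV_iterate_snd]
        exact phiMap_iterate_mem_Icc hp₁ hp₁' hz.2 k
      · rw [Finset.card_range, nsmul_eq_mul, mul_comm]
    by_cases h1 : z.2 ∈ D₁ n
    · refine hbad.trans (le_trans ?_ (le_trans le_add_self le_self_add))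
      refine le_trans ?_ (ENNReal.le_tsum n)
      rw [indicator_of_mem h1, Pi.one_apply, mul_one]
    by_cases h2 : z.2 ∈ D₂ n
    · refine hbad.trans (le_trans ?_ le_add_self)
      refine le_trans ?_ (ENNReal.le_tsum n)
      rw [indicator_of_mem h2, Pi.one_apply, mul_one]
    refine le_trans ?_ (le_trans le_self_add le_self_add)
    refine ENNReal.ofReal_le_ofReal ?_
    have hdev : |birkhoffSum (phiMap p₁) m n z.2| ≤ (n : ℝ) ^ (1 / 2 + ε) := not_lt.1 h1
    have hθ1 : (n : ℝ) ^ (1 / 2 + ε) ≤ (n : ℝ) ^ θ :=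
      Real.rpow_le_rpow_of_exponent_le hn1 (le_max_left _ _)
    have hθ2 : (n : ℝ) ^ (1 - γ / β) ≤ (n : ℝ) ^ θ :=
      Real.rpow_le_rpow_of_exponent_le hn1 (le_max_right _ _)
    have hθ3 : 1 ≤ (n : ℝ) ^ θ := Real.one_le_rpow hn1 hθ0.le
    have hbound : |inducedObs α β p₁ f z| ≤ A * (n : ℝ) ^ θ := by
      have h3 := hmf z.2 hz.2 n
      have h4 := mul_le_mul_of_nonneg_left hθ2 hA'
      have h5 := mul_le_mul_of_nonneg_left hθ3 (by linarith : 0 ≤ 2 * M)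
      rw [hA, add_mul, add_mul, one_mul]
      linarith
    calc |inducedObs α β p₁ f z| ^ q ≤ (A * (n : ℝ) ^ θ) ^ q :=
          Real.rpow_le_rpow (abs_nonneg _) hbound hq0.le
      _ = A ^ q * (n : ℝ) ^ (θ * q) := by
          rw [Real.mul_rpow hA0.le (by positivity), ← Real.rpow_mul (by positivity)]
      _ ≤ A ^ q * (K * (2 * z.1 - 1) ^ (-α)) ^ (θ * q) := by
          gcongr
          exact hret h2
      _ = _ := by
          rw [Real.mul_rpow hK0.le (by positivity), ← Real.rpow_mul hx0.le, ← mul_assoc, neg_mul]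
  have hνle : ν.restrict Δ0 ≤ (2 : ℝ≥0∞) • volume.restrict Δ0 := by
    refine Measure.le_iff.2 fun s hs => ?_
    rw [Measure.smul_apply, smul_eq_mul, Measure.restrict_apply hs, Measure.restrict_apply hs]
    exact measure_le_two_mul_volume hα hαβ hp₁ hp₁' ν hac hsupp hinv (hs.inter hmΔ)
      inter_subset_right
  have hI₀ : ∫⁻ z in Δ0, B₀ z < ⊤ := setLIntegral_Δ0_rpow_lt_top hκ
  have hI₁ : ∫⁻ z in Δ0, B₁ z < ⊤ := setLIntegral_Δ0_tsum_lt_top hD₁ (by positivity)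
    (tsum_rpow_mul_volume_deviationSet_lt_top hp₁ hp₁' hm hmM hm0 hε hq0)
  have hI₂ : ∫⁻ z in Δ0, B₂ z < ⊤ := setLIntegral_Δ0_tsum_lt_top hD₂ (by positivity)
    (tsum_rpow_mul_volume_deviationSet_lt_top hp₁ hp₁' measurable_centredLeft
      (fun ω _ => abs_centredLeft_le hp₁ hp₁' ω) (fun ω hω => centredLeft_average hp₁ hp₁' hω)
      hε hq0)
  calc ∫⁻ z in Δ0, ENNReal.ofReal (|inducedObs α β p₁ f z| ^ q) ∂ν
      ≤ ∫⁻ z in Δ0, (B₀ z + B₁ z + B₂ z) ∂ν := setLIntegral_mono' hmΔ hpt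
    _ ≤ ∫⁻ z, (B₀ z + B₁ z + B₂ z) ∂((2 : ℝ≥0∞) • volume.restrict Δ0) :=
        lintegral_mono' hνle le_rfl
    _ = 2 * ((∫⁻ z in Δ0, B₀ z) + (∫⁻ z in Δ0, B₁ z) + ∫⁻ z in Δ0, B₂ z) := by
        rw [lintegral_smul_measure, lintegral_add_left (f := fun z => B₀ z + B₁ z) (hB₀m.add hB₁m),
          lintegral_add_left hB₀m,
          smul_eq_mul]
    _ < ⊤ := ENNReal.mul_lt_top (by simp) (ENNReal.add_lt_top.2
        ⟨ENNReal.add_lt_top.2 ⟨hI₀, hI₁⟩, hI₂⟩)
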